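/- arXiv:math-ph/0305039 — 2 statements merged into one kernel-verified Lean document; each statement's English description precedes it below -/
import Mathlib

section
/- For all positive integers m and N and every real number h > 0, the identity Σ_{ε ∈ {−1,+1}} Σ_{j=0}^{N−1} ε · exp( m·h·( j + (m+ε)/(2m) )² ) = (π m h)^{−1/2} · ∫_{−∞}^{∞} exp( −z²/(m h) + N z ) · ( 2 sinh(N z) sinh(z/m) / sinh(z) ) dz holds, where the integrand is extended continuously across its removable singularity at z = 0. -/
open scoped Real BigOperators
open MeasureTheory

/-- Completing the square in a Gaussian exponent with a linear term. -/
lemma exp_neg_sq_div_add_mul_eq {a : ℝ} (ha : 0 < a) (c z : ℝ) :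
    Real.exp (-(z ^ 2) / a + c * z)
      = Real.exp (a * (c / 2) ^ 2) * Real.exp (-a⁻¹ * (z - a * c / 2) ^ 2) := by
  rw [← Real.exp_add]
  congr 1
  field_simp
  ring

lemma integrable_exp_neg_sq_div_add_mul {a : ℝ} (ha : 0 < a) (c : ℝ) :
    Integrable fun z : ℝ => Real.exp (-(z ^ 2) / a + c * z) := by
  simp_rw [exp_neg_sq_div_add_mul_eq ha]
  exact ((integrable_exp_neg_mul_sq (inv_pos.2 ha)).comp_sub_right (a * c / 2)).const_mul _

lemma integral_exp_neg_sq_div_add_mul {a : ℝ} (ha : 0 < a) (c : ℝ) :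
    ∫ z : ℝ, Real.exp (-(z ^ 2) / a + c * z) = √(π * a) * Real.exp (a * (c / 2) ^ 2) := by
  simp_rw [exp_neg_sq_div_add_mul_eq ha]
  rw [integral_const_mul,
    integral_sub_right_eq_self (fun z : ℝ => Real.exp (-a⁻¹ * z ^ 2)) (a * c / 2),
    integral_gaussian, div_inv_eq_mul, mul_comm]

lemma exp_mul_sinh_eq_sinh_mul_sum (N : ℕ) (z : ℝ) :
    Real.exp (N * z) * Real.sinh (N * z)
      = Real.sinh z * ∑ j ∈ Finset.range N, Real.exp ((2 * j + 1) * z) := by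
  induction N with
  | zero => simp
  | succ n ih =>
    rw [Finset.sum_range_succ, mul_add, ← ih]
    simp only [Real.sinh_eq, mul_div_assoc', div_mul_eq_mul_div, mul_sub, sub_mul,
      ← Real.exp_add]
    push_cast
    ring_nf

lemma exp_mul_sinh_mul_sinh_div_sinh (N : ℕ) (a b z : ℝ) :
    Real.exp (-(z ^ 2) / a + N * z) *
        (if z = 0 then 0 else 2 * Real.sinh (N * z) * Real.sinh (z / b) / Real.sinh z)
      = ∑ j ∈ Finset.range N, (Real.exp (-(z ^ 2) / a + (2 * j + 1 + b⁻¹) * z)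
          - Real.exp (-(z ^ 2) / a + (2 * j + 1 - b⁻¹) * z)) := by
  split_ifs with hz
  · simp [hz]
  · have hs : Real.sinh z ≠ 0 := by simpa using hz
    have hterm (j : ℕ) : Real.exp (-(z ^ 2) / a + (2 * j + 1 + b⁻¹) * z)
          - Real.exp (-(z ^ 2) / a + (2 * j + 1 - b⁻¹) * z)
        = Real.exp (-(z ^ 2) / a) * (2 * Real.sinh (z / b)) * Real.exp ((2 * j + 1) * z) := by
      simp only [Real.sinh_eq, mul_div_cancel₀ _ (two_ne_zero' ℝ), mul_sub, sub_mul,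
        ← Real.exp_add]
      ring_nf
    simp_rw [hterm]
    rw [← Finset.mul_sum, Real.exp_add, mul_div_assoc', div_eq_iff hs]
    linear_combination 2 * Real.exp (-(z ^ 2) / a) * Real.sinh (z / b) *
      exp_mul_sinh_eq_sinh_mul_sum N z

/-- For all positive integers `m`, `N` and every real `h > 0`,
`Σ_{ε∈{−1,+1}} Σ_{j=0}^{N−1} ε · exp(m·h·(j+(m+ε)/(2m))²)
  = (π m h)^{−1/2} · ∫_ℝ exp(−z²/(mh)+Nz) · (2 sinh(Nz) sinh(z/m)/sinh(z)) dz`,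
the integrand being extended continuously across its removable singularity at `z = 0`
(where its value is `0`). -/
theorem stmt0 (m N : ℕ) (hm : 0 < m) (hN : 0 < N) (h : ℝ) (hh : 0 < h) :
    ((∑ j ∈ Finset.range N, Real.exp ((m : ℝ) * h * ((j : ℝ) + ((m : ℝ) + 1) / (2 * m)) ^ 2))
      - ∑ j ∈ Finset.range N, Real.exp ((m : ℝ) * h * ((j : ℝ) + ((m : ℝ) - 1) / (2 * m)) ^ 2))
    = (Real.sqrt (π * m * h))⁻¹ *
        ∫ z : ℝ, Real.exp (-(z ^ 2) / (m * h) + N * z) *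
          (if z = 0 then 0
           else 2 * Real.sinh (N * z) * Real.sinh (z / m) / Real.sinh z) := by
  have hm' : (0 : ℝ) < m := Nat.cast_pos.2 hm
  have ha : 0 < (m : ℝ) * h := mul_pos hm' hh
  have hint := integrable_exp_neg_sq_div_add_mul ha
  simp_rw [exp_mul_sinh_mul_sinh_div_sinh]
  rw [integral_finsetSum _ (by exact fun j _ => (hint _).sub (hint _)), ← Finset.sum_sub_distrib,
    Finset.mul_sum]
  refine Finset.sum_congr rfl fun j _ => ?_
  have hsqrt : √(π * (m * h)) ≠ 0 := (Real.sqrt_pos.2 (mul_pos Real.pi_pos ha)).ne'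
  rw [integral_sub (hint _) (hint _), integral_exp_neg_sq_div_add_mul ha,
    integral_exp_neg_sq_div_add_mul ha, ← mul_sub, mul_assoc π, inv_mul_cancel_left₀ hsqrt]
  congr 4 <;> field_simp <;> ring
end

section
/- Fix an integer m ≥ 2. For a positive integer N let ω = exp(2πi/N) and S_m(N) = Σ_{c_1,…,c_{m−1}=0}^{N−1} (−1)^{c_{m−1}} ω^{c_{m−1}(c_{m−1}+1)/2} Π_{i=1}^{m−2} ω^{c_i(c_i+1)} [c_{i+1} choose c_i]_ω. Then S_m(N) has the asymptotic expansion: for every nonnegative integer K there is a constant C_K such that for all N ≥ 1, | S_m(N) − √N · e^{3πi/4 − (m−1)²πi/(2mN)} · √(2/m) · Σ_{k=1}^{m−1} (−1)^k (k−m) sin(kπ/m) e^{−k²πiN/(2m)} − e^{−(m−1)²πi/(2mN)} · Σ_{k=0}^{K−1} (E_k^{(m;0)}/k!) (πi/(2mN))^k | ≤ C_K · N^{−K}. -/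
open scoped Real BigOperators
open Complex (I)

/-- The Gaussian binomial coefficient `[M choose n]_q` as a function of `q : ℂ`:
the integer polynomial `Π_{j=1}^{n} (1 − q^{M−n+j})/(1 − q^{j})` evaluated at `q`
(well defined even at roots of unity), equal to `0` unless `M ≥ n ≥ 0`; defined via
the `q`-Pascal recursion. -/
def qBinom (q : ℂ) : ℕ → ℕ → ℂ
  | _, 0 => 1
  | 0, _ + 1 => 0
  | M + 1, n + 1 => q ^ (n + 1) * qBinom q M (n + 1) + qBinom q M n

/-- `S_m(N) = Σ_{c_1,…,c_{m−1}=0}^{N−1} (−1)^{c_{m−1}} ω^{c_{m−1}(c_{m−1}+1)/2}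
Π_{i=1}^{m−2} ω^{c_i(c_i+1)} [c_{i+1} choose c_i]_ω`, `ω = exp(2πi/N)`, `m = p+2`. -/
noncomputable def kashaevSum (p N : ℕ) : ℂ :=
  ∑ c : Fin (p + 1) → Fin N,
    (-1 : ℂ) ^ ((c (Fin.last p) : ℕ)) *
      Complex.exp (2 * (π : ℂ) * I / N) ^
        (((c (Fin.last p) : ℕ) * ((c (Fin.last p) : ℕ) + 1)) / 2) *
      ∏ j : Fin p,
        Complex.exp (2 * (π : ℂ) * I / N) ^
            ((c j.castSucc : ℕ) * ((c j.castSucc : ℕ) + 1)) *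
          qBinom (Complex.exp (2 * (π : ℂ) * I / N)) (c j.succ) (c j.castSucc)

open Finset in
/-- The `q`-Pochhammer product `∏_{j < n} (1 - b q ^ j)`. -/
def qPoch (q b : ℂ) (n : ℕ) : ℂ := ∏ j ∈ range n, (1 - b * q ^ j)

lemma qPoch_succ (q b : ℂ) (n : ℕ) : qPoch q b (n + 1) = qPoch q b n * (1 - b * q ^ n) :=
  Finset.prod_range_succ _ _

lemma qPoch_succ' (q b : ℂ) (n : ℕ) :
    qPoch q b (n + 1) = (1 - b) * qPoch q (b * q) n := by
  simp only [qPoch, Finset.prod_range_succ']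
  rw [mul_comm]
  congr 1
  · simp
  · exact Finset.prod_congr rfl fun j _ => by ring

lemma qPoch_add (q b : ℂ) (n k : ℕ) :
    qPoch q b (n + k) = qPoch q b n * qPoch q (b * q ^ n) k := by
  simp only [qPoch, Finset.prod_range_add]
  congr 1
  exact Finset.prod_congr rfl fun j _ => by ring

lemma qPoch_ne_zero {q b : ℂ} {n : ℕ} (h : ∀ j < n, b * q ^ j ≠ 1) : qPoch q b n ≠ 0 :=
  Finset.prod_ne_zero_iff.2 fun j hj => sub_ne_zero.2 (h j (Finset.mem_range.1 hj)).symm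

lemma qBinom_zero_right (q : ℂ) (n : ℕ) : qBinom q n 0 = 1 := by
  cases n <;> rfl

lemma qBinom_succ_succ (q : ℂ) (n k : ℕ) :
    qBinom q (n + 1) (k + 1) = q ^ (k + 1) * qBinom q n (k + 1) + qBinom q n k := rfl

lemma qBinom_eq_zero (q : ℂ) : ∀ {n k : ℕ}, n < k → qBinom q n k = 0
  | 0, k + 1, _ => rfl
  | n + 1, k + 1, h => by
    rw [qBinom_succ_succ, qBinom_eq_zero q (by omega : n < k + 1),
      qBinom_eq_zero q (by omega : n < k)]
    ring

lemma qBinom_self (q : ℂ) (n : ℕ) : qBinom q n n = 1 := by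
  induction n with
  | zero => rfl
  | succ n ih => rw [qBinom_succ_succ, qBinom_eq_zero q (Nat.lt_succ_self n), ih]; ring

lemma qBinom_add_mul (q : ℂ) (a b : ℕ) :
    qBinom q (a + b) a * (qPoch q q a * qPoch q q b) = qPoch q q (a + b) := by
  induction a generalizing b with
  | zero => simp [qBinom_zero_right, qPoch]
  | succ a iha =>
    induction b with
    | zero => simp [qBinom_self, qPoch]
    | succ b ihb =>
      have h1 := iha (b + 1)
      rw [show a + 1 + (b + 1) = (a + 1 + b) + 1 by ring, qBinom_succ_succ]
      rw [show a + (b + 1) = a + 1 + b by ring] at h1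
      rw [qPoch_succ q q (a + 1 + b)]
      rw [qPoch_succ q q b] at h1 ⊢
      rw [qPoch_succ q q a] at ihb ⊢
      linear_combination (q ^ (a + 1) * (1 - q * q ^ b)) * ihb + (1 - q * q ^ a) * h1

lemma qBinom_mul_qBinom {q : ℂ} {r s t : ℕ} (h : qPoch q q (r + s + t) ≠ 0) :
    qBinom q (r + s + t) (r + s) * qBinom q (r + s) r =
      qBinom q (r + s + t) r * qBinom q (s + t) s := by
  have h1 := qBinom_add_mul q (r + s) t
  have h2 := qBinom_add_mul q r s
  have h3 := qBinom_add_mul q r (s + t)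
  have h4 := qBinom_add_mul q s t
  rw [← add_assoc] at h3
  have hrs : qPoch q q (r + s) ≠ 0 := fun h0 => h (by rw [← h1, h0]; ring)
  have hst : qPoch q q (s + t) ≠ 0 := fun h0 => h (by rw [← h3, h0]; ring)
  have ht : qPoch q q t ≠ 0 := fun h0 => h (by rw [← h1, h0]; ring)
  have hr : qPoch q q r ≠ 0 := fun h0 => hrs (by rw [← h2, h0]; ring)
  have hs : qPoch q q s ≠ 0 := fun h0 => hrs (by rw [← h2, h0]; ring)
  rw [← eq_div_iff (by positivity)] at h1 h2 h3 h4
  rw [h1, h2, h3, h4]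
  field_simp

/-- A `q`-analogue of the Chu–Vandermonde identity. -/
lemma sum_qBinom_mul_qPoch (q : ℂ) (n : ℕ) (b : ℂ) :
    ∑ s ∈ Finset.range (n + 1),
      b ^ s * q ^ (s ^ 2) * qBinom q n s * qPoch q (b * q ^ (s + 1)) (n - s) = 1 := by
  induction n generalizing b with
  | zero => simp [qBinom, qPoch]
  | succ n ih =>
    rw [Finset.sum_range_succ']
    have h1 : ∀ s ∈ Finset.range (n + 1),
        b ^ (s + 1) * q ^ ((s + 1) ^ 2) * qBinom q (n + 1) (s + 1) *
          qPoch q (b * q ^ (s + 1 + 1)) (n + 1 - (s + 1)) =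
        b ^ (s + 1) * q ^ ((s + 1) ^ 2 + (s + 1)) * qBinom q n (s + 1) *
            qPoch q (b * q ^ (s + 1 + 1)) (n - s) +
          b ^ (s + 1) * q ^ ((s + 1) ^ 2) * qBinom q n s *
            qPoch q (b * q ^ (s + 1 + 1)) (n - s) := by
      intro s _
      rw [qBinom_succ_succ, show n + 1 - (s + 1) = n - s by omega]
      ring
    rw [Finset.sum_congr rfl h1, Finset.sum_add_distrib]
    have h2 := Finset.sum_range_succ' (fun s => b ^ s * q ^ (s ^ 2 + s) * qBinom q n s *
            qPoch q (b * q ^ (s + 1)) (n + 1 - s)) (n + 1)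
    rw [Finset.sum_range_succ, qBinom_eq_zero q (Nat.lt_succ_self n)] at h2
    simp only [qBinom_zero_right, Nat.add_sub_add_right, mul_zero, zero_mul, add_zero] at h2 ⊢
    rw [add_right_comm, ← h2, ← Finset.sum_add_distrib, ← ih (b * q)]
    refine Finset.sum_congr rfl fun s hs => ?_
    have hs' : s ≤ n := by simpa [Nat.lt_succ_iff] using hs
    rw [show n + 1 - s = (n - s) + 1 by omega, qPoch_succ']
    rw [show b * q * q ^ (s + 1) = b * q ^ (s + 1 + 1) by ring,
      show b * q ^ (s + 1) * q = b * q ^ (s + 1 + 1) by ring]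
    ring

/-- The sums produced from `δ_{n,0}` by iterating the Bailey transform with parameter `a`. -/
def baileySum (q a : ℂ) : ℕ → ℕ → ℂ
  | 0, n => if n = 0 then 1 else 0
  | k + 1, n => ∑ c ∈ Finset.range (n + 1),
      a ^ c * q ^ (c ^ 2) * qBinom q n c * baileySum q a k c

/-- The numerators of the unit Bailey pair. -/
def baileyCoeff (q a : ℂ) (r : ℕ) : ℂ := (-1) ^ r * q ^ (r.choose 2) * (1 - a * q ^ (2 * r))

lemma sum_baileyCoeff {q a : ℂ} (ha : ∀ j, a * q ^ j ≠ 1) {n : ℕ} (hn : n ≠ 0)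
    (hq : qPoch q q n ≠ 0) :
    ∑ r ∈ Finset.range (n + 1), qBinom q n r * baileyCoeff q a r / qPoch q (a * q ^ r) (n + 1) =
      0 := by
  obtain ⟨l, rfl⟩ := Nat.exists_eq_succ_of_ne_zero hn
  have hP : ∀ r k, qPoch q (a * q ^ r) k ≠ 0 := fun r k => qPoch_ne_zero fun j _ => by
    rw [mul_assoc, ← pow_add]; exact ha _
  have key : ∀ k, ∑ r ∈ Finset.range (k + 1),
      qBinom q (l + 1) r * baileyCoeff q a r / qPoch q (a * q ^ r) (l + 1 + 1) =
      (-1) ^ k * q ^ ((k + 1).choose 2) * qBinom q l k / qPoch q (a * q ^ (k + 1)) (l + 1) := by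
    intro k
    induction k with
    | zero =>
      rw [Finset.sum_range_one, qBinom_zero_right, qBinom_zero_right]
      have h2 := hP 0 (l + 1 + 1)
      have h3 := hP 1 (l + 1)
      rw [pow_zero, mul_one] at h2
      rw [pow_one] at h3
      rw [zero_add, pow_one, div_eq_div_iff (by simpa using h2) h3]
      simp only [pow_zero, mul_one, qPoch_succ' q a, baileyCoeff]
      simp
    | succ k ih =>
      rw [Finset.sum_range_succ, ih]
      have e1 : qPoch q (a * q ^ (k + 1)) (l + 1 + 1) =
          (1 - a * q ^ (k + 1)) * qPoch q (a * q ^ (k + 1 + 1)) (l + 1) := by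
        rw [qPoch_succ', show a * q ^ (k + 1) * q = a * q ^ (k + 1 + 1) by ring]
      have e2 : qPoch q (a * q ^ (k + 1)) (l + 1 + 1) =
          qPoch q (a * q ^ (k + 1)) (l + 1) * (1 - a * q ^ (k + 1) * q ^ (l + 1)) :=
        qPoch_succ _ _ _
      have n1 := hP (k + 1) (l + 1 + 1)
      have n2 := hP (k + 1) (l + 1)
      have n3 := hP (k + 1 + 1) (l + 1)
      have hpas : (1 - q ^ (l + 1)) * qBinom q l k =
          qBinom q (l + 1) (k + 1) * (1 - q ^ (k + 1)) := by
        rcases lt_or_ge l k with h | h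
        · rw [qBinom_eq_zero q h, qBinom_eq_zero q (by omega)]; ring
        · obtain ⟨d, rfl⟩ := Nat.exists_eq_add_of_le h
          have h1 := qBinom_add_mul q k d
          have h2 := qBinom_add_mul q (k + 1) d
          rw [show k + 1 + d = k + d + 1 by ring] at h2
          rw [qPoch_succ q q (k + d), qPoch_succ q q k] at h2
          have hk : qPoch q q (k + d) ≠ 0 := fun h0 =>
            hq (by rw [Nat.succ_eq_add_one, qPoch_succ, h0]; ring)
          have hk' : qPoch q q k * qPoch q q d ≠ 0 := fun h0 => hk (by rw [← h1, h0]; ring)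
          refine mul_right_cancel₀ hk' ?_
          linear_combination (1 - q * q ^ (k + d)) * h1 - h2
      have hch : (k + 1 + 1).choose 2 = (k + 1).choose 2 + (k + 1) := by
        rw [Nat.choose_succ_succ' (k + 1) 1]; simp [add_comm]
      rw [hch]
      have n4 : 1 - a * q ^ (k + 1) ≠ 0 := sub_ne_zero.2 (ha _).symm
      have n5 : 1 - a * q ^ (k + 1) * q ^ (l + 1) ≠ 0 := fun h0 => n1 (by rw [e2, h0]; ring)
      have e3 : (qPoch q (a * q ^ (k + 1)) (l + 1))⁻¹ =
          (1 - a * q ^ (k + 1) * q ^ (l + 1)) / qPoch q (a * q ^ (k + 1)) (l + 1 + 1) := by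
        rw [e2]; field_simp
      have e4 : (qPoch q (a * q ^ (k + 1 + 1)) (l + 1))⁻¹ =
          (1 - a * q ^ (k + 1)) / qPoch q (a * q ^ (k + 1)) (l + 1 + 1) := by
        rw [e1]; field_simp
      rw [div_eq_mul_inv _ (qPoch q (a * q ^ (k + 1)) (l + 1)), e3,
        div_eq_mul_inv _ (qPoch q (a * q ^ (k + 1 + 1)) (l + 1)), e4]
      simp only [mul_div_assoc', ← add_div]
      congr 1
      rw [baileyCoeff]
      have hrec := qBinom_succ_succ q l k
      have : q ^ (2 * (k + 1)) = q ^ (k + 1) * q ^ (k + 1) := by ring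
      rw [this, pow_add q ((k + 1).choose 2), pow_succ (-1 : ℂ) k]
      generalize q ^ (k + 1) = u at *
      generalize q ^ (l + 1) = v at *
      generalize qBinom q (l + 1) (k + 1) = A at *
      linear_combination ((-1) ^ k * q ^ ((k + 1).choose 2)) * (a * u * hpas - (1 - a * u) * hrec)
  have := key (l + 1)
  rw [qBinom_eq_zero q (Nat.lt_succ_self l)] at this
  simpa using this

lemma qPoch_ne_zero_of_le {q b : ℂ} {k n : ℕ} (hkn : k ≤ n) (h : qPoch q b n ≠ 0) :
    qPoch q b k ≠ 0 := by
  obtain ⟨d, rfl⟩ := Nat.exists_eq_add_of_le hkn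
  rw [qPoch_add] at h
  exact left_ne_zero_of_mul h

lemma sum_qBinom_mul_div_qPoch {q a : ℂ} (ha : ∀ j, a * q ^ j ≠ 1) {n r : ℕ} (hr : r ≤ n)
    (hq : qPoch q q n ≠ 0) :
    ∑ c ∈ Finset.range (n + 1),
      a ^ c * q ^ (c ^ 2) * qBinom q n c * qBinom q c r / qPoch q (a * q ^ r) (c + 1) =
    qBinom q n r * (a ^ r * q ^ (r ^ 2)) / qPoch q (a * q ^ r) (n + 1) := by
  have hP : ∀ r k, qPoch q (a * q ^ r) k ≠ 0 := fun r k => qPoch_ne_zero fun j _ => by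
    rw [mul_assoc, ← pow_add]; exact ha _
  obtain ⟨d, rfl⟩ := Nat.exists_eq_add_of_le hr
  rw [add_assoc, Finset.sum_range_add, Finset.sum_eq_zero, zero_add]
  · rw [eq_div_iff (hP _ _), Finset.sum_mul, ← mul_one (qBinom q (r + d) r * _),
      ← sum_qBinom_mul_qPoch q d (a * q ^ (2 * r)), Finset.mul_sum]
    refine Finset.sum_congr rfl fun s hs => ?_
    obtain ⟨t, rfl⟩ := Nat.exists_eq_add_of_le
      (show s ≤ d by simpa [Nat.lt_succ_iff] using hs)
    have h1 := qBinom_mul_qBinom (q := q) (r := r) (s := s) (t := t) (by rwa [add_assoc])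
    have h2 : qPoch q (a * q ^ r) (r + (s + t + 1)) = qPoch q (a * q ^ r) (r + s + 1) *
        qPoch q (a * q ^ (2 * r) * q ^ (s + 1)) t := by
      rw [show r + (s + t + 1) = r + s + 1 + t by ring, qPoch_add]
      congr 2
      ring
    rw [h2, Nat.add_sub_cancel_left, ← add_assoc r s t]
    have := hP r (r + s + 1)
    field_simp
    rw [mul_assoc (a ^ (r + s) * q ^ ((r + s) ^ 2)), h1]
    ring
  · intro c hc
    rw [qBinom_eq_zero q (Finset.mem_range.1 hc)]
    simp

lemma baileySum_eq {q a : ℂ} (ha : ∀ j, a * q ^ j ≠ 1) (k : ℕ) {n : ℕ} (hq : qPoch q q n ≠ 0) :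
    baileySum q a k n = ∑ r ∈ Finset.range (n + 1),
      qBinom q n r * baileyCoeff q a r * (a ^ r * q ^ (r ^ 2)) ^ k /
        qPoch q (a * q ^ r) (n + 1) := by
  induction k generalizing n with
  | zero =>
    simp only [pow_zero, mul_one]
    rcases eq_or_ne n 0 with rfl | hn
    · have := ha 0
      simp only [pow_zero, mul_one] at this
      simp [baileySum, baileyCoeff, qPoch, qBinom_zero_right, sub_ne_zero.2 this.symm]
    · rw [sum_baileyCoeff ha hn hq, baileySum, if_neg hn]
  | succ k ih =>
    rw [baileySum]
    have h1 : ∀ c ∈ Finset.range (n + 1),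
        a ^ c * q ^ (c ^ 2) * qBinom q n c * baileySum q a k c =
        ∑ r ∈ Finset.range (n + 1), (baileyCoeff q a r * (a ^ r * q ^ (r ^ 2)) ^ k) *
          (a ^ c * q ^ (c ^ 2) * qBinom q n c * qBinom q c r / qPoch q (a * q ^ r) (c + 1)) := by
      intro c hc
      have hc' : c ≤ n := by simpa [Nat.lt_succ_iff] using hc
      rw [ih (qPoch_ne_zero_of_le hc' hq), Finset.mul_sum]
      rw [← Finset.sum_subset (Finset.range_mono (by omega : c + 1 ≤ n + 1))]
      · exact Finset.sum_congr rfl fun r _ => by ring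
      · intro r _ hr
        rw [qBinom_eq_zero q (by simpa using hr : c < r)]
        simp
    rw [Finset.sum_congr rfl h1, Finset.sum_comm]
    refine Finset.sum_congr rfl fun r hr => ?_
    rw [← Finset.mul_sum, sum_qBinom_mul_div_qPoch ha (by simpa [Nat.lt_succ_iff] using hr) hq]
    ring

/-! ### Specialization to roots of unity -/

lemma qPoch_self_ne_zero {q : ℂ} {N n : ℕ} (hq : IsPrimitiveRoot q N) (hn : n < N) :
    qPoch q q n ≠ 0 :=
  qPoch_ne_zero fun j hj => by
    rw [← pow_succ']
    exact hq.pow_ne_one_of_pos_of_lt (by omega) (by omega)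

lemma qPoch_self_eq_zero {q : ℂ} {N : ℕ} (hq : IsPrimitiveRoot q N) (hN : 0 < N) :
    qPoch q q N = 0 := by
  obtain ⟨n, rfl⟩ := Nat.exists_eq_succ_of_ne_zero hN.ne'
  have := hq.pow_eq_one
  rw [Nat.succ_eq_add_one, qPoch_succ, ← pow_succ', this]
  simp

lemma qPoch_rootOfUnity {q : ℂ} {N : ℕ} (hq : IsPrimitiveRoot q N) (hN : 0 < N) (b : ℂ) :
    qPoch q b N = 1 - b ^ N := by
  have h := hq.pow_sub_pow_eq_prod_sub_mul 1 b hN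
  rw [one_pow] at h
  rw [h, qPoch]
  have : NeZero N := ⟨hN.ne'⟩
  refine Finset.prod_bij (fun j _ => q ^ j) ?_ ?_ ?_ ?_
  · intro j _
    rw [Polynomial.mem_nthRootsFinset hN, ← pow_mul, mul_comm, pow_mul, hq.pow_eq_one, one_pow]
  · intro i hi j hj hij
    exact hq.pow_inj (Finset.mem_range.1 hi) (Finset.mem_range.1 hj) hij
  · intro z hz
    rw [Polynomial.mem_nthRootsFinset hN] at hz
    obtain ⟨i, hi, rfl⟩ := hq.eq_pow_of_pow_eq_one hz
    exact ⟨i, Finset.mem_range.2 hi, rfl⟩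
  · intro j _
    ring

lemma qBinom_pred_rootOfUnity {q : ℂ} {n : ℕ} (hq : IsPrimitiveRoot q (n + 1)) {r : ℕ}
    (hr : r ≤ n) : q ^ ((r + 1).choose 2) * qBinom q n r = (-1) ^ r := by
  induction r with
  | zero => simp [qBinom_zero_right]
  | succ r ih =>
    obtain ⟨d, rfl⟩ := Nat.exists_eq_add_of_le hr
    have h0 : qBinom q (r + 1 + d + 1) (r + 1) = 0 := by
      have h := qBinom_add_mul q (r + 1) (d + 1)
      rw [← add_assoc, qPoch_self_eq_zero hq (by omega)] at h
      exact (mul_eq_zero.1 h).resolve_right (mul_ne_zero (qPoch_self_ne_zero hq (by omega))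
        (qPoch_self_ne_zero hq (by omega)))
    rw [qBinom_succ_succ] at h0
    have hch : (r + 1 + 1).choose 2 = (r + 1).choose 2 + (r + 1) := by
      rw [Nat.choose_succ_succ' (r + 1) 1]; simp [add_comm]
    rw [hch, pow_add q ((r + 1).choose 2), pow_succ (-1 : ℂ)]
    linear_combination (q ^ ((r + 1).choose 2)) * h0 - ih (by omega)

lemma baileySum_rootOfUnity {q a : ℂ} {n : ℕ} (hq : IsPrimitiveRoot q (n + 1))
    (ha : a ^ (n + 1) ≠ 1) (k : ℕ) :
    baileySum q a k n * (1 - a ^ (n + 1)) = ∑ r ∈ Finset.range (n + 1),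
      (a ^ r * q ^ (r ^ 2)) ^ k * (q⁻¹) ^ r * (1 - a * q ^ (2 * r)) := by
  have hq0 : q ≠ 0 := hq.ne_zero (by omega)
  have haj : ∀ j, (a * q ^ j) ^ (n + 1) = a ^ (n + 1) := fun j => by
    rw [mul_pow, ← pow_mul, mul_comm j, pow_mul, hq.pow_eq_one]; simp
  have ha' : ∀ j, a * q ^ j ≠ 1 := fun j h => ha (by rw [← haj j, h, one_pow])
  rw [baileySum_eq ha' k (qPoch_self_ne_zero hq (by omega)), Finset.sum_mul]
  refine Finset.sum_congr rfl fun r hr => ?_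
  have hr' : r ≤ n := by simpa [Nat.lt_succ_iff] using hr
  have h1 := qBinom_pred_rootOfUnity hq hr'
  have hch : (r + 1).choose 2 = r.choose 2 + r := by
    rw [Nat.choose_succ_succ' r 1]; simp [add_comm]
  rw [qPoch_rootOfUnity hq (by omega), haj, div_mul_cancel₀ _ (sub_ne_zero.2 ha.symm), baileyCoeff]
  have h2 : qBinom q n r * ((-1) ^ r * q ^ (r.choose 2)) = q⁻¹ ^ r := by
    rw [hch, pow_add] at h1
    have : ((-1 : ℂ) ^ r) * (-1) ^ r = 1 := by rw [← mul_pow]; simp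
    rw [inv_pow]
    refine eq_inv_of_mul_eq_one_left ?_
    linear_combination (-1) ^ r * h1 + this
  linear_combination ((a ^ r * q ^ (r ^ 2)) ^ k * (1 - a * q ^ (2 * r))) * h2

lemma differentiable_baileySum (q : ℂ) (k n : ℕ) : Differentiable ℂ fun a => baileySum q a k n := by
  induction k generalizing n with
  | zero => simp only [baileySum]; fun_prop
  | succ k ih =>
    simp only [baileySum]
    refine Differentiable.fun_sum fun c _ => ?_
    have := ih c
    fun_prop

lemma baileySum_self_rootOfUnity {q : ℂ} {n : ℕ} (hq : IsPrimitiveRoot q (n + 1)) (k : ℕ) :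
    ((n : ℂ) + 1) * baileySum q q k n = ∑ r ∈ Finset.range (n + 1),
      (q ^ (r * (r + 1))) ^ k * (q ^ (r + 1) - k * r * (q⁻¹ ^ r - q ^ (r + 1))) := by
  have hq0 : q ≠ 0 := hq.ne_zero (by omega)
  set L : ℂ → ℂ := fun a => baileySum q a k n * (1 - a ^ (n + 1)) with hL
  set Rt : ℕ → ℂ → ℂ := fun r a =>
    (a ^ r * q ^ (r ^ 2)) ^ k * (q⁻¹) ^ r * (1 - a * q ^ (2 * r)) with hRt
  have hev : L =ᶠ[nhds q] fun a => ∑ r ∈ Finset.range (n + 1), Rt r a := by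
    have hc1 : Continuous L :=
      ((differentiable_baileySum q k n).continuous).mul (by fun_prop)
    have hc2 : Continuous fun a => ∑ r ∈ Finset.range (n + 1), Rt r a := by
      simp only [hRt]; fun_prop
    have hden : Dense {a : ℂ | a ^ (n + 1) ≠ 1} := by
      have : {a : ℂ | a ^ (n + 1) ≠ 1} =
          ((Polynomial.nthRootsFinset (n + 1) (1 : ℂ) : Finset ℂ) : Set ℂ)ᶜ := by
        ext a
        simp
      rw [this]
      exact (Finset.countable_toSet _).dense_compl ℝ
    have := Continuous.ext_on hden hc1 hc2 fun a ha => baileySum_rootOfUnity hq ha k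
    rw [this]
  have hLd : HasDerivAt L (baileySum q q k n * (-((n + 1 : ℕ) * q ^ n))) q := by
    have h1 := ((differentiable_baileySum q k n) q).hasDerivAt
    have h2 : HasDerivAt (fun a : ℂ => 1 - a ^ (n + 1)) (-((n + 1 : ℕ) * q ^ n)) q := by
      simpa using (hasDerivAt_pow (n + 1) q).const_sub 1
    have h3 := h1.mul h2
    rw [hq.pow_eq_one, sub_self, mul_zero, zero_add] at h3
    exact h3
  have hRd : ∀ r, HasDerivAt (Rt r) ((k * r : ℕ) * q ^ (k * r - 1) * q ^ (r ^ 2 * k) * q⁻¹ ^ r *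
      (1 - q * q ^ (2 * r)) + (q ^ (k * r) * q ^ (r ^ 2 * k) * q⁻¹ ^ r) * (-q ^ (2 * r))) q := by
    intro r
    have h1 := (((hasDerivAt_pow (k * r) q).mul_const (q ^ (r ^ 2 * k))).mul_const (q⁻¹ ^ r))
    have h2 : HasDerivAt (fun a : ℂ => 1 - a * q ^ (2 * r)) (-q ^ (2 * r)) q := by
      simpa using ((hasDerivAt_id q).mul_const (q ^ (2 * r))).const_sub 1
    convert! h1.mul h2 using 1
    funext a
    simp only [hRt, Pi.mul_apply]
    ring
  have hRs := HasDerivAt.fun_sum (u := Finset.range (n + 1)) fun r _ => hRd r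
  have huniq := hLd.unique (hRs.congr_of_eventuallyEq hev)
  have hqn : q ^ n * q = 1 := by rw [← pow_succ, hq.pow_eq_one]
  have h4 : ((n : ℂ) + 1) * baileySum q q k n =
      -(q * (baileySum q q k n * (-((n + 1 : ℕ) * q ^ n)))) := by
    push_cast
    linear_combination (-(((n : ℂ) + 1) * baileySum q q k n)) * hqn
  rw [h4, huniq, Finset.mul_sum, ← Finset.sum_neg_distrib]
  refine Finset.sum_congr rfl fun r _ => ?_
  have h5 : ((k * r : ℕ) : ℂ) * q ^ (k * r - 1) * q = (k * r : ℕ) * q ^ (k * r) := by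
    rcases Nat.eq_zero_or_pos (k * r) with h | h
    · simp [h]
    · rw [mul_assoc, ← pow_succ, Nat.sub_add_cancel h]
  have h6 : q⁻¹ ^ r * q ^ r = 1 := by rw [← mul_pow, inv_mul_cancel₀ hq0, one_pow]
  have h7 : (q ^ (r * (r + 1))) ^ k = q ^ (k * r) * q ^ (r ^ 2 * k) := by ring
  rw [h7]
  push_cast at h5 ⊢
  have h8 : q ^ (r + 1) = q * q ^ r := by ring
  have h9 : q ^ (2 * r) = q ^ r * q ^ r := by ring
  rw [h8, h9]
  linear_combination (-(q ^ (r ^ 2 * k) * q⁻¹ ^ r * (1 - q * (q ^ r * q ^ r)))) * h5 +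
    (q ^ (k * r) * q ^ (r ^ 2 * k) * q * q ^ r * (1 + k * r)) * h6

lemma sum_fin_chain {N : ℕ} (h : Fin N → ℂ) (B : Fin N → Fin N → ℂ) (F : ℕ → Fin N → ℂ)
    (hF0 : ∀ x, F 0 x = 1) (hF : ∀ k x, F (k + 1) x = ∑ c, h c * B x c * F k c) (p : ℕ)
    (g : Fin N → ℂ) :
    ∑ c : Fin (p + 1) → Fin N, g (c (Fin.last p)) *
      ∏ j : Fin p, (h (c j.castSucc) * B (c j.succ) (c j.castSucc)) = ∑ x, g x * F p x := by
  induction p generalizing g with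
  | zero =>
    simp only [Finset.univ_eq_empty, Finset.prod_empty, mul_one, hF0]
    exact Fintype.sum_equiv (Equiv.funUnique (Fin 1) (Fin N)) _ _ fun c => rfl
  | succ p ih =>
    rw [← (Fin.snocEquiv (fun _ : Fin (p + 2) => Fin N)).sum_comp, Fintype.sum_prod_type,
      Finset.sum_comm]
    have := ih fun y => ∑ x, g x * (h y * B x y)
    simp only [hF]
    have e1 : ∑ x, (∑ x', g x' * (h x * B x' x)) * F p x =
        ∑ x, g x * ∑ c, h c * B x c * F p c := by
      simp only [Finset.sum_mul, Finset.mul_sum]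
      rw [Finset.sum_comm]
      exact Finset.sum_congr rfl fun _ _ => Finset.sum_congr rfl fun _ _ => by ring
    rw [← e1, ← this]
    refine Finset.sum_congr rfl fun c _ => ?_
    rw [Finset.sum_mul]
    refine Finset.sum_congr rfl fun x _ => ?_
    rw [Fin.prod_univ_castSucc]
    simp only [Fin.snocEquiv_apply, Fin.snoc_last, Fin.snoc_castSucc, Fin.succ_last,
      Fin.succ_castSucc]
    ring

lemma kashaevSum_eq_baileySum (p n : ℕ) :
    kashaevSum p (n + 1) = baileySum (Complex.exp (2 * π * I / (n + 1 : ℕ)))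
      (Complex.exp (2 * π * I / (n + 1 : ℕ))) (p + 2) n := by
  have hq := Complex.isPrimitiveRoot_exp (n + 1) (by omega)
  rw [kashaevSum]
  set q := Complex.exp (2 * π * I / (n + 1 : ℕ)) with hqdef
  have h1 : ∀ l, baileySum q q 1 l = 1 := by
    intro l
    simp only [baileySum]
    rw [Finset.sum_eq_single 0] <;> simp +contextual [qBinom_zero_right]
  have hrec : ∀ k (x : Fin (n + 1)), baileySum q q (k + 1 + 1) x =
      ∑ c : Fin (n + 1), q ^ ((c : ℕ) * (c + 1)) * qBinom q x c * baileySum q q (k + 1) c := by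
    intro k x
    rw [baileySum, Fin.sum_univ_eq_sum_range
      (fun c => q ^ (c * (c + 1)) * qBinom q x c * baileySum q q (k + 1) c) (n + 1)]
    rw [← Finset.sum_subset (Finset.range_mono (by omega : (x : ℕ) + 1 ≤ n + 1))]
    · exact Finset.sum_congr rfl fun c _ => by ring
    · intro c _ hc
      rw [qBinom_eq_zero q (by simpa using hc : (x : ℕ) < c)]
      simp
  have h2 := sum_fin_chain (fun c : Fin (n + 1) => q ^ ((c : ℕ) * (c + 1)))
    (fun x c => qBinom q x c) (fun k x => baileySum q q (k + 1) x) (fun x => h1 x) hrec p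
    (fun x => (-1) ^ (x : ℕ) * q ^ ((x : ℕ) * (x + 1) / 2))
  rw [h2]
  have h3 := hrec p (Fin.last n)
  rw [Fin.val_last] at h3
  rw [h3]
  refine Finset.sum_congr rfl fun x _ => ?_
  have hx := qBinom_pred_rootOfUnity hq (Nat.lt_succ_iff.1 x.2)
  have h4 : q ^ ((x : ℕ) * (x + 1)) = q ^ ((x : ℕ) * (x + 1) / 2) * q ^ ((x + 1 : ℕ).choose 2) := by
    rw [← pow_add, Nat.choose_two_right, Nat.add_sub_cancel, mul_comm ((x : ℕ) + 1)]
    congr 1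
    have := Nat.even_mul_succ_self (x : ℕ)
    obtain ⟨y, hy⟩ := this
    omega
  rw [h4, ← hx]
  ring

/-! ### The invariant as a weighted Gauss sum -/

/-- The quadratic phase `exp (π i x² / (2 m N))`. -/
noncomputable def quadPhase (m N : ℕ) (x : ℂ) : ℂ := Complex.exp (π * I * x ^ 2 / (2 * m * N))

lemma quadPhase_reflect {m N : ℕ} (hm : m ≠ 0) (hN : N ≠ 0) (n : ℤ) :
    quadPhase m N (2 * m * N - n) = quadPhase m N n := by
  have hm' : (m : ℂ) ≠ 0 := by exact_mod_cast hm
  have hN' : (N : ℂ) ≠ 0 := by exact_mod_cast hN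
  rw [quadPhase, quadPhase]
  refine Complex.exp_eq_exp_iff_exists_int.2 ⟨m * N - n, ?_⟩
  push_cast
  field_simp
  ring

lemma sum_quadPhase_eq {m N : ℕ} (hm : m ≠ 0) (hN : N ≠ 0) :
    ∑ r ∈ Finset.range N, quadPhase m N (2 * m * r + m - 1) =
      ∑ r ∈ Finset.range N, quadPhase m N (2 * m * r + m + 1) := by
  rw [← Finset.sum_range_reflect]
  refine Finset.sum_congr rfl fun r hr => ?_
  have hr' := Finset.mem_range.1 hr
  have := quadPhase_reflect hm hN (2 * m * r + m + 1)
  push_cast at this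
  rw [← this]
  congr 1
  rw [Nat.sub_sub, Nat.cast_sub (by omega)]
  push_cast
  ring

lemma kashaevSum_eq {p N : ℕ} (hN : N ≠ 0) {m : ℕ} (hm : m = p + 2) :
    kashaevSum p N = Complex.exp (-(((m : ℂ) - 1) ^ 2) * π * I / (2 * m * N)) *
      (1 / (2 * N) * ∑ r ∈ Finset.range N,
        ((2 * m * r + m + 1) * quadPhase m N (2 * m * r + m + 1) -
          (2 * m * r + m - 1) * quadPhase m N (2 * m * r + m - 1))) := by
  have hm0 : m ≠ 0 := by omega
  have hm' : (m : ℂ) ≠ 0 := by exact_mod_cast hm0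
  have hN' : (N : ℂ) ≠ 0 := by exact_mod_cast hN
  have hsum := sum_quadPhase_eq hm0 hN
  have hexp : ∀ r : ℕ, (Complex.exp (2 * π * I / N) ^ (r * (r + 1))) ^ m *
      Complex.exp (2 * π * I / N) ^ (r + 1) =
      Complex.exp (-(((m : ℂ) - 1) ^ 2) * π * I / (2 * m * N)) *
        quadPhase m N (2 * m * r + m + 1) := by
    intro r
    rw [quadPhase, ← pow_mul, ← Complex.exp_nat_mul, ← Complex.exp_nat_mul, ← Complex.exp_add,
      ← Complex.exp_add]
    congr 1
    push_cast
    field_simp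
    ring
  have hexp' : ∀ r : ℕ, (Complex.exp (2 * π * I / N) ^ (r * (r + 1))) ^ m *
      (Complex.exp (2 * π * I / N))⁻¹ ^ r =
      Complex.exp (-(((m : ℂ) - 1) ^ 2) * π * I / (2 * m * N)) *
        quadPhase m N (2 * m * r + m - 1) := by
    intro r
    rw [quadPhase, ← pow_mul, ← Complex.exp_neg, ← Complex.exp_nat_mul, ← Complex.exp_nat_mul,
      ← Complex.exp_add, ← Complex.exp_add]
    congr 1
    push_cast
    field_simp
    ring
  obtain ⟨n, rfl⟩ := Nat.exists_eq_succ_of_ne_zero hN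
  have hq := Complex.isPrimitiveRoot_exp (n + 1) (by omega)
  have h := baileySum_self_rootOfUnity hq (p + 2)
  rw [← kashaevSum_eq_baileySum, ← hm] at h
  simp only [Nat.succ_eq_add_one] at *
  set q := Complex.exp (2 * π * I / (n + 1 : ℕ)) with hqdef
  set W := Complex.exp (-(((m : ℂ) - 1) ^ 2) * π * I / (2 * m * (n + 1 : ℕ))) with hW
  have h2 : ∀ r : ℕ, (q ^ (r * (r + 1))) ^ m * (q ^ (r + 1) - m * r * (q⁻¹ ^ r - q ^ (r + 1))) =
      W / 2 * (((2 * m * r + m + 1) * quadPhase m (n + 1) (2 * m * r + m + 1) -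
          (2 * m * r + m - 1) * quadPhase m (n + 1) (2 * m * r + m - 1))) -
      W * (m - 1) / 2 * (quadPhase m (n + 1) (2 * m * r + m + 1) -
        quadPhase m (n + 1) (2 * m * r + m - 1)) := by
    intro r
    linear_combination (1 + m * r) * hexp r - m * r * hexp' r
  simp only [h2] at h
  have h3 : ∑ r ∈ Finset.range (n + 1), (quadPhase m (n + 1) (2 * m * r + m + 1) -
      quadPhase m (n + 1) (2 * m * r + m - 1)) = 0 := by
    rw [Finset.sum_sub_distrib, hsum, sub_self]
  rw [Finset.sum_sub_distrib, ← Finset.mul_sum, ← Finset.mul_sum, h3, mul_zero, sub_zero] at h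
  push_cast at hN'
  have h4 : ∀ S : ℂ, W / 2 * S = (n + 1) * (W * (1 / (2 * (n + 1 : ℕ)) * S)) := by
    intro S
    push_cast
    field_simp
  exact mul_left_cancel₀ hN' (h.trans (h4 _))

/-! ### Shifting a horizontal line of integration past a simple pole -/

open Filter Topology MeasureTheory in
lemma tendsto_integral_inv_add_mul_I {a : ℝ} (ha : a ≠ 0) :
    Tendsto (fun R : ℝ => ∫ t in (-R)..R, ((t : ℂ) + a * I)⁻¹) atTop
      (𝓝 (-(SignType.sign a : ℝ) * π * I)) := by
  have hne : ∀ t : ℝ, (t : ℂ) + a * I ≠ 0 := fun t h => ha (by simpa using congrArg Complex.im h)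
  have hintg : ∀ R : ℝ, ∫ t in (-R)..R, ((t : ℂ) + a * I)⁻¹ =
      ((-2 * Real.arctan (R / a) : ℝ) : ℂ) * I := by
    intro R
    have hd : ∀ t : ℝ, HasDerivAt (fun t : ℝ => ((1 / 2 * Real.log (t ^ 2 + a ^ 2) : ℝ) : ℂ) -
        ((Real.arctan (t / a) : ℝ) : ℂ) * I) (((t : ℂ) + a * I)⁻¹) t := by
      intro t
      have hpos : 0 < t ^ 2 + a ^ 2 := by positivity
      have h1 : HasDerivAt (fun t : ℝ => 1 / 2 * Real.log (t ^ 2 + a ^ 2))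
          (t / (t ^ 2 + a ^ 2)) t := by
        have := (((hasDerivAt_pow 2 t).add_const (a ^ 2)).log hpos.ne').const_mul (1 / 2)
        convert! this using 1
        field_simp
        simp [mul_comm]
      have h2 : HasDerivAt (fun t : ℝ => Real.arctan (t / a)) (a / (t ^ 2 + a ^ 2)) t := by
        have := ((hasDerivAt_id t).div_const a).arctan
        convert! this using 1
        simp only [id]
        field_simp
        ring
      convert! h1.ofReal_comp.sub (h2.ofReal_comp.mul_const I) using 1
      have hposC : (t : ℂ) ^ 2 + (a : ℂ) ^ 2 ≠ 0 := by exact_mod_cast hpos.ne'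
      have := hne t
      push_cast
      field_simp
      linear_combination (a : ℂ) ^ 2 * Complex.I_sq
    rw [intervalIntegral.integral_eq_sub_of_hasDerivAt (fun t _ => hd t)]
    · rw [neg_div, Real.arctan_neg, neg_sq]
      push_cast
      ring
    · refine Continuous.intervalIntegrable ?_ _ _
      exact Continuous.inv₀ (by fun_prop) hne
  simp only [hintg]
  have key : Tendsto (fun R : ℝ => -2 * Real.arctan (R / a)) atTop
      (𝓝 (-(SignType.sign a : ℝ) * π)) := by
    rcases lt_or_gt_of_ne ha with h | h
    · rw [sign_neg h]
      have h1 := (Real.tendsto_arctan_atBot.mono_right nhdsWithin_le_nhds).comp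
        (tendsto_id.atTop_div_const_of_neg h)
      convert! h1.const_mul (-2) using 2
      simp
      ring
    · rw [sign_pos h]
      have h1 := (Real.tendsto_arctan_atTop.mono_right nhdsWithin_le_nhds).comp
        (tendsto_id.atTop_div_const h)
      convert! h1.const_mul (-2) using 2
      simp
      ring
  have := ((Complex.continuous_ofReal.tendsto _).comp key).mul_const I
  simpa using this

open Filter Topology MeasureTheory Set in
/-- The difference of the integrals of `f` over two horizontal lines enclosing a single simple
pole `w` with residue `c`. -/
lemma integral_line_sub_integral_line {f G : ℂ → ℂ} {w c : ℂ} {y₁ y₂ : ℝ} (h₁ : y₁ < w.im)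
    (h₂ : w.im < y₂) (hG : DifferentiableOn ℂ G (Complex.im ⁻¹' Icc y₁ y₂))
    (hf : ∀ u : ℂ, u.im ∈ Icc y₁ y₂ → u ≠ w → f u = G u + c * (u - w)⁻¹)
    (hintg₁ : Integrable fun x : ℝ => f (x + y₁ * I))
    (hintg₂ : Integrable fun x : ℝ => f (x + y₂ * I))
    {K X : ℝ} (hK : ∀ u : ℂ, u.im ∈ Icc y₁ y₂ → X ≤ |u.re| → ‖f u‖ ≤ K / (1 + u.re ^ 2)) :
    (∫ x : ℝ, f (x + y₁ * I)) - ∫ x : ℝ, f (x + y₂ * I) = 2 * π * I * c := by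
  set x₀ := w.re with hx₀
  have hw : w = x₀ + w.im * I := (Complex.re_add_im w).symm
  have hleft : Tendsto (fun R : ℝ => -R + x₀) atTop atBot :=
    tendsto_atBot_add_const_right _ _ tendsto_neg_atTop_atBot
  have hright : Tendsto (fun R : ℝ => R + x₀) atTop atTop :=
    tendsto_atTop_add_const_right _ _ tendsto_id
  have hline : ∀ y : ℝ, y ∈ Icc y₁ y₂ → y ≠ w.im → Integrable (fun x : ℝ => f (x + y * I)) →
      Tendsto (fun R : ℝ => ∫ x in (-R + x₀)..(R + x₀), G (x + y * I)) atTop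
        (𝓝 ((∫ x : ℝ, f (x + y * I)) - c * (-(SignType.sign (y - w.im) : ℝ) * π * I))) := by
    intro y hy hyw hi
    have hne : ∀ t : ℝ, (t : ℂ) + y * I - w ≠ 0 := fun t h => hyw (by
      have := congrArg Complex.im h
      simp at this
      linarith)
    have e : ∀ R : ℝ, ∫ x in (-R + x₀)..(R + x₀), G (x + y * I) =
        (∫ x in (-R + x₀)..(R + x₀), f (x + y * I)) -
          c * ∫ t in (-R)..R, ((t : ℂ) + (y - w.im : ℝ) * I)⁻¹ := by
      intro R
      have e1 : ∫ t in (-R)..R, ((t : ℂ) + (y - w.im : ℝ) * I)⁻¹ =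
          ∫ x in (-R + x₀)..(R + x₀), ((x : ℂ) + y * I - w)⁻¹ := by
        rw [← intervalIntegral.integral_comp_add_right (fun x : ℝ => ((x : ℂ) + y * I - w)⁻¹) x₀]
        congr 1
        funext t
        congr 1
        rw [hw]
        push_cast
        simp
        ring
      rw [e1, ← intervalIntegral.integral_const_mul, ← intervalIntegral.integral_sub]
      · refine intervalIntegral.integral_congr fun x _ => ?_
        have := hf (x + y * I) (by simpa using hy) (sub_ne_zero.1 (hne x))
        simp only [this]
        ring
      · exact hi.intervalIntegrable
      · exact (Continuous.inv₀ (by fun_prop) hne).intervalIntegrable _ _ |>.const_mul c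
    simp only [e]
    exact (intervalIntegral_tendsto_integral hi hleft hright).sub
      ((tendsto_integral_inv_add_mul_I (sub_ne_zero.2 hyw)).const_mul c)
  have hvert : ∀ s : ℝ, |s| = 1 → Tendsto (fun R : ℝ => ∫ y in y₁..y₂, G ((s * R + x₀ : ℝ) + y * I))
      atTop (𝓝 0) := by
    intro s hs
    have hs2 : s ^ 2 = 1 := by rw [← sq_abs, hs, one_pow]
    have habs : Tendsto (fun R : ℝ => |s * R + x₀|) atTop atTop := by
      refine tendsto_atTop_mono' _ ?_ (tendsto_atTop_add_const_right atTop (-|x₀|) tendsto_id)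
      filter_upwards [eventually_ge_atTop 0] with R hR
      have := abs_sub_abs_le_abs_sub (s * R) (-x₀)
      rw [abs_mul, hs, one_mul, abs_of_nonneg hR, abs_neg, sub_neg_eq_add] at this
      exact this
    have hb : Tendsto (fun R : ℝ => (K / (1 + |s * R + x₀| ^ 2) + ‖c‖ * R⁻¹) * |y₂ - y₁|)
        atTop (𝓝 0) := by
      have t1 : Tendsto (fun R : ℝ => K / (1 + |s * R + x₀| ^ 2)) atTop (𝓝 0) :=
        tendsto_const_nhds.div_atTop
          (tendsto_atTop_add_const_left _ _ ((tendsto_pow_atTop two_ne_zero).comp habs))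
      have t2 : Tendsto (fun R : ℝ => ‖c‖ * R⁻¹) atTop (𝓝 (‖c‖ * 0)) :=
        tendsto_inv_atTop_zero.const_mul _
      simpa using (t1.add t2).mul_const |y₂ - y₁|
    refine squeeze_zero_norm' ?_ hb
    filter_upwards [habs.eventually_ge_atTop X, eventually_gt_atTop 0] with R hR hR0
    refine intervalIntegral.norm_integral_le_of_norm_le_const fun y hy => ?_
    rw [uIoc_of_le (h₁.trans h₂).le] at hy
    set u : ℂ := (s * R + x₀ : ℝ) + y * I with hu
    have hre : u.re = s * R + x₀ := by simp [hu]
    have him : u.im = y := by simp [hu]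
    have hmem : u.im ∈ Icc y₁ y₂ := by rw [him]; exact ⟨hy.1.le, hy.2⟩
    have hdist : R ≤ ‖u - w‖ := by
      have := Complex.abs_re_le_norm (u - w)
      rw [Complex.sub_re, hre, ← hx₀, add_sub_cancel_right, abs_mul, hs, one_mul,
        abs_of_pos hR0] at this
      exact this
    have huw : u ≠ w := fun h => by rw [h, sub_self, norm_zero] at hdist; linarith
    have hGu : G u = f u - c * (u - w)⁻¹ := by rw [hf u hmem huw]; ring
    rw [hGu]
    refine (norm_sub_le _ _).trans (add_le_add ?_ ?_)
    · rw [sq_abs, ← hre]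
      exact hK u hmem (by rw [hre]; exact hR)
    · rw [norm_mul, norm_inv]
      gcongr
  have hrect : ∀ R : ℝ, (∫ x in (-R + x₀)..(R + x₀), G (x + y₁ * I)) -
      (∫ x in (-R + x₀)..(R + x₀), G (x + y₂ * I)) +
      I * (∫ y in y₁..y₂, G ((1 * R + x₀ : ℝ) + y * I)) -
      I * (∫ y in y₁..y₂, G (((-1) * R + x₀ : ℝ) + y * I)) = 0 := by
    intro R
    have := Complex.integral_boundary_rect_eq_zero_of_differentiableOn G
      (⟨-R + x₀, y₁⟩) (⟨R + x₀, y₂⟩) (hG.mono fun u hu => by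
        rw [Complex.mem_reProdIm, uIcc_of_le (h₁.trans h₂).le] at hu
        exact hu.2)
    simpa using this
  have h0 := (((hline y₁ ⟨le_rfl, (h₁.trans h₂).le⟩ h₁.ne hintg₁).sub
    (hline y₂ ⟨(h₁.trans h₂).le, le_rfl⟩ h₂.ne' hintg₂)).add
    ((hvert 1 (by simp)).const_mul I)).sub ((hvert (-1) (by simp)).const_mul I)
  simp only [hrect] at h0
  have h3 := tendsto_nhds_unique h0 tendsto_const_nhds
  rw [sign_neg (sub_neg.2 h₁), sign_pos (sub_pos.2 h₂)] at h3
  simp at h3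
  linear_combination h3

open MeasureTheory Set Topology in
/-- The difference of the integrals of a quotient `A / S` over two horizontal lines enclosing a
single simple zero of `S`. -/
lemma integral_line_sub_integral_line_div {f A S : ℂ → ℂ} {w : ℂ} {y₁ y₂ : ℝ} (h₁ : y₁ < w.im)
    (h₂ : w.im < y₂) (hA : Differentiable ℂ A) (hS : Differentiable ℂ S) (hSw : S w = 0)
    (hS' : deriv S w ≠ 0) (hne : ∀ u : ℂ, u.im ∈ Icc y₁ y₂ → u ≠ w → S u ≠ 0)
    (hf : ∀ u : ℂ, u.im ∈ Icc y₁ y₂ → u ≠ w → f u = A u / S u)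
    (hintg₁ : Integrable fun x : ℝ => f (x + y₁ * I))
    (hintg₂ : Integrable fun x : ℝ => f (x + y₂ * I))
    {K X : ℝ} (hK : ∀ u : ℂ, u.im ∈ Icc y₁ y₂ → X ≤ |u.re| → ‖f u‖ ≤ K / (1 + u.re ^ 2)) :
    (∫ x : ℝ, f (x + y₁ * I)) - ∫ x : ℝ, f (x + y₂ * I) = 2 * π * I * (A w / deriv S w) := by
  set s : Set ℂ := Complex.im ⁻¹' Icc y₁ y₂ with hs
  have hws : s ∈ 𝓝 w := Complex.continuous_im.continuousAt.preimage_mem_nhds (Icc_mem_nhds h₁ h₂)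
  have hsl : ∀ u, u ≠ w → S u = (u - w) * dslope S w u := fun u hu => by
    rw [dslope_of_ne _ hu, slope_def_field, hSw, sub_zero, mul_div_cancel₀ _ (sub_ne_zero.2 hu)]
  have hQ : DifferentiableOn ℂ (dslope S w) s :=
    (Complex.differentiableOn_dslope hws).2 hS.differentiableOn
  have hQ0 : ∀ u ∈ s, dslope S w u ≠ 0 := by
    intro u hu
    by_cases huw : u = w
    · rwa [huw, dslope_same]
    · exact fun h => hne u hu huw (by rw [hsl u huw, h, mul_zero])
  have hC : DifferentiableOn ℂ (fun u => A u / dslope S w u) s := hA.differentiableOn.div hQ hQ0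
  refine integral_line_sub_integral_line h₁ h₂ ((Complex.differentiableOn_dslope hws).2 hC)
    (fun u hu huw => ?_) hintg₁ hintg₂ hK
  have huw' := sub_ne_zero.2 huw
  have h0 := hQ0 u hu
  rw [hf u hu huw, hsl u huw, dslope_of_ne (fun u => A u / dslope S w u) huw,
    slope_def_field (fun u => A u / dslope S w u),
    dslope_same]
  field_simp
  ring

open MeasureTheory Filter Asymptotics in
lemma integrable_of_le_inv_one_add_sq {f : ℝ → ℂ} (hf : Continuous f) {K X : ℝ}
    (hK : ∀ x, X ≤ |x| → ‖f x‖ ≤ K / (1 + x ^ 2)) : Integrable f := by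
  refine hf.locallyIntegrable.integrable_of_isBigO_cocompact
    (g := fun x : ℝ => (1 + x ^ 2)⁻¹) (IsBigO.of_bound K ?_)
    (integrable_inv_one_add_sq.integrableAtFilter _)
  have : ∀ᶠ x : ℝ in cocompact ℝ, X ≤ |x| :=
    (tendsto_norm_cocompact_atTop (E := ℝ)).eventually_ge_atTop X
  filter_upwards [this] with x hx
  rw [Real.norm_of_nonneg (by positivity), ← div_eq_mul_inv]
  exact hK x hx

lemma exists_norm_gaussian_le {b : ℝ} (hb : 0 < b) (Y : ℝ) :
    ∃ K : ℝ, ∀ u : ℂ, |u.im| ≤ Y →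
      (1 + ‖u‖) * ‖Complex.exp (-b * u ^ 2)‖ ≤ K / (1 + u.re ^ 2) := by
  refine ⟨(2 + Y) * (2 + 4 / b ^ 2) * Real.exp (b * Y ^ 2), fun u hu => ?_⟩
  set x := u.re with hx
  have hY : 0 ≤ Y := (abs_nonneg _).trans hu
  have h1 : ‖u‖ ≤ |x| + Y := (Complex.norm_le_abs_re_add_abs_im u).trans (by gcongr)
  have h2 : ‖Complex.exp (-b * u ^ 2)‖ ≤ Real.exp (b * Y ^ 2) * (Real.exp (b * x ^ 2))⁻¹ := by
    rw [Complex.norm_exp, ← Real.exp_neg, ← Real.exp_add]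
    refine Real.exp_le_exp.2 ?_
    have h3 : u.im ^ 2 ≤ Y ^ 2 := by rw [← sq_abs]; gcongr
    have : (-b * u ^ 2 : ℂ).re = -b * (x ^ 2 - u.im ^ 2) := by
      rw [show (-b * u ^ 2 : ℂ) = ((-b : ℝ) : ℂ) * u ^ 2 by push_cast; ring, Complex.re_ofReal_mul,
        pow_two, Complex.mul_re]
      ring
    rw [this]
    nlinarith
  have h4 : (1 + x ^ 2) ^ 2 ≤ (2 + 4 / b ^ 2) * Real.exp (b * x ^ 2) := by
    have e1 : 1 ≤ Real.exp (b * x ^ 2) := Real.one_le_exp (by positivity)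
    have e2 : (b * x ^ 2) ^ 2 / 2 ≤ Real.exp (b * x ^ 2) := by
      have := Real.quadratic_le_exp_of_nonneg (x := b * x ^ 2) (by positivity)
      nlinarith [show 0 ≤ b * x ^ 2 by positivity]
    have e3 : 4 / b ^ 2 * ((b * x ^ 2) ^ 2 / 2) ≤ 4 / b ^ 2 * Real.exp (b * x ^ 2) := by gcongr
    have e4 : 4 / b ^ 2 * ((b * x ^ 2) ^ 2 / 2) = 2 * x ^ 4 := by field_simp; ring
    nlinarith [sq_nonneg (x ^ 2 - 1)]
  have h5 : 1 + ‖u‖ ≤ (2 + Y) * (1 + x ^ 2) := by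
    have : |x| ≤ 1 + x ^ 2 := by rw [← sq_abs]; nlinarith [sq_nonneg (|x| - 1), abs_nonneg x]
    nlinarith [sq_nonneg x, mul_nonneg hY (sq_nonneg x)]
  rw [le_div_iff₀ (by positivity)]
  calc (1 + ‖u‖) * ‖Complex.exp (-b * u ^ 2)‖ * (1 + x ^ 2)
      ≤ ((2 + Y) * (1 + x ^ 2)) * (Real.exp (b * Y ^ 2) * (Real.exp (b * x ^ 2))⁻¹) *
        (1 + x ^ 2) := by gcongr
    _ = (2 + Y) * Real.exp (b * Y ^ 2) * ((1 + x ^ 2) ^ 2 * (Real.exp (b * x ^ 2))⁻¹) := by ring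
    _ ≤ (2 + Y) * Real.exp (b * Y ^ 2) * (2 + 4 / b ^ 2) := by
        gcongr
        rwa [← div_eq_mul_inv, div_le_iff₀ (Real.exp_pos _)]
    _ = _ := by ring

/-! ### The function `m sinh z / sinh (m z)` -/

/-- The function `m sinh z / sinh (m z)`, with its removable singularities removed. -/
noncomputable def sinhQuot (m : ℕ) (z : ℂ) : ℂ :=
  m / ∑ j ∈ Finset.range m, Complex.exp ((2 * j + 1 - m) * z)

lemma sinh_mul_sum_exp (m : ℕ) (z : ℂ) :
    Complex.sinh z * ∑ j ∈ Finset.range m, Complex.exp ((2 * j + 1 - m) * z) =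
      Complex.sinh (m * z) := by
  have h : ∀ j ∈ Finset.range m, Complex.sinh z * Complex.exp ((2 * j + 1 - m) * z) =
      Complex.exp ((2 * ((j + 1 : ℕ) : ℂ) - m) * z) / 2 - Complex.exp ((2 * j - m) * z) / 2 := by
    intro j _
    rw [Complex.sinh, div_mul_eq_mul_div, sub_mul, ← Complex.exp_add, ← Complex.exp_add, sub_div]
    congr 3 <;> push_cast <;> ring
  rw [Finset.mul_sum, Finset.sum_congr rfl h,
    Finset.sum_range_sub fun j : ℕ => Complex.exp ((2 * (j : ℂ) - m) * z) / 2, Complex.sinh,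
    sub_div]
  congr 3
  · ring
  · push_cast; ring

lemma sinhQuot_eq (m : ℕ) {z : ℂ} (hz : Complex.sinh z ≠ 0) :
    sinhQuot m z = m * Complex.sinh z / Complex.sinh (m * z) := by
  rw [← sinh_mul_sum_exp, sinhQuot, mul_comm (m : ℂ), mul_div_mul_left _ _ hz]

lemma sinh_nat_mul_eq_zero {z : ℂ} (hz : Complex.sinh z = 0) (m : ℕ) :
    Complex.sinh (m * z) = 0 := by
  rw [← sinh_mul_sum_exp, hz, zero_mul]

lemma exists_int_of_sinh_eq_zero {z : ℂ} (hz : Complex.sinh z = 0) : ∃ n : ℤ, z = n * π * I := by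
  obtain ⟨n, hn⟩ := Complex.sin_eq_zero_iff.1 (show Complex.sin (z * I) = 0 by
    rw [Complex.sin_mul_I, hz, zero_mul])
  refine ⟨-n, ?_⟩
  push_cast
  linear_combination (-I) * hn + z * Complex.I_sq

lemma sinhQuot_add (m : ℕ) (z : ℂ) : sinhQuot m (z + 2 * π * I) = sinhQuot m z := by
  rw [sinhQuot, sinhQuot]
  congr 1
  refine Finset.sum_congr rfl fun j _ => Complex.exp_eq_exp_iff_exists_int.2 ⟨2 * j + 1 - m, ?_⟩
  push_cast
  ring

lemma norm_sinhQuot_le {m : ℕ} (hm : m ≠ 0) {z : ℂ} {ε : ℝ} (hε : 0 < ε) (hz : ε ≤ |z.re|) :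
    ‖sinhQuot m z‖ ≤ m * (1 + (Real.sinh ε)⁻¹) := by
  have hlow : ∀ w : ℂ, Real.sinh |w.re| ≤ ‖Complex.sinh w‖ := by
    intro w
    have := Complex.abs_re_le_norm w
    have h : ‖Complex.sinh w‖ ^ 2 = Real.sinh w.re ^ 2 + Real.sin w.im ^ 2 := by
      rw [← Complex.normSq_eq_norm_sq, Complex.normSq_apply]
      nth_rewrite 1 2 3 4 [← Complex.re_add_im w]
      rw [Complex.sinh_add, Complex.sinh_mul_I, Complex.cosh_mul_I]
      simp [← Complex.ofReal_sin, ← Complex.ofReal_cos, ← Complex.ofReal_sinh,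
        ← Complex.ofReal_cosh]
      nlinarith [Real.sin_sq_add_cos_sq w.im, Real.cosh_sq w.re]
    refine abs_le_of_sq_le_sq' ?_ (norm_nonneg _) |>.2
    rw [h]
    rcases abs_choice w.re with h' | h' <;> rw [h'] <;> simp <;> positivity
  have hup : ‖Complex.sinh z‖ ≤ Real.cosh |z.re| := by
    rw [Real.cosh_abs, Complex.sinh, Real.cosh_eq, norm_div]
    have := norm_sub_le (Complex.exp z) (Complex.exp (-z))
    rw [Complex.norm_exp, Complex.norm_exp, Complex.neg_re] at this
    simpa using div_le_div_of_nonneg_right this two_pos.le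
  have hs : 0 < Real.sinh |z.re| := Real.sinh_pos_iff.2 (hε.trans_le hz)
  have hz0 : Complex.sinh z ≠ 0 := fun h => by
    have := hlow z
    rw [h, norm_zero] at this
    linarith
  have hm1 : Real.sinh |z.re| ≤ ‖Complex.sinh (m * z)‖ := by
    refine le_trans (Real.sinh_le_sinh.2 ?_) (hlow _)
    rw [← Complex.ofReal_natCast, Complex.re_ofReal_mul, abs_mul, Nat.abs_cast]
    have : (1 : ℝ) ≤ m := by exact_mod_cast Nat.one_le_iff_ne_zero.2 hm
    nlinarith [abs_nonneg z.re]
  rw [sinhQuot_eq m hz0, mul_div_assoc, norm_mul, Complex.norm_natCast, norm_div]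
  gcongr
  calc ‖Complex.sinh z‖ / ‖Complex.sinh (m * z)‖ ≤ Real.cosh |z.re| / Real.sinh |z.re| := by
        gcongr
    _ ≤ (Real.sinh |z.re| + 1) / Real.sinh |z.re| := by
        gcongr
        have := Real.cosh_sub_sinh |z.re|
        have : Real.exp (-|z.re|) ≤ 1 := Real.exp_le_one_iff.2 (by simp)
        linarith
    _ = 1 + (Real.sinh |z.re|)⁻¹ := by field_simp
    _ ≤ 1 + (Real.sinh ε)⁻¹ := by
        have := Real.sinh_le_sinh.2 hz
        have := Real.sinh_pos_iff.2 hε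
        gcongr

lemma sum_exp_ne_zero {m : ℕ} (hm : m ≠ 0) {z : ℂ} (hz : z = 0 ∨ Complex.sinh (m * z) ≠ 0) :
    ∑ j ∈ Finset.range m, Complex.exp ((2 * j + 1 - m) * z) ≠ 0 := by
  rcases hz with rfl | hz
  · simpa using hm
  · exact fun h => hz (by rw [← sinh_mul_sum_exp, h, mul_zero])

lemma differentiableAt_sinhQuot {m : ℕ} (hm : m ≠ 0) {z : ℂ}
    (hz : z = 0 ∨ Complex.sinh (m * z) ≠ 0) : DifferentiableAt ℂ (sinhQuot m) z := by
  unfold sinhQuot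
  exact (differentiableAt_const _).div (by fun_prop) (sum_exp_ne_zero hm hz)

/-! ### A Mordell-type integral -/

/-- The primitive eighth root of unity `exp (π i / 4)`. -/
noncomputable def eighthRoot : ℂ := Complex.exp (π * I / 4)

lemma eighthRoot_ne_zero : eighthRoot ≠ 0 := Complex.exp_ne_zero _

lemma eighthRoot_sq : eighthRoot ^ 2 = I := by
  rw [eighthRoot, ← Complex.exp_nat_mul]
  conv_rhs => rw [← Complex.exp_pi_div_two_mul_I]
  congr 1
  push_cast
  ring

lemma eighthRoot_eq : eighthRoot = (√2 / 2 : ℝ) + (√2 / 2 : ℝ) * I := by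
  rw [eighthRoot, show (π * I / 4 : ℂ) = ((π / 4 : ℝ) : ℂ) * I by push_cast; ring,
    Complex.exp_mul_I, ← Complex.ofReal_cos, ← Complex.ofReal_sin, Real.cos_pi_div_four,
    Real.sin_pi_div_four]

lemma norm_eighthRoot : ‖eighthRoot‖ = 1 := by
  rw [eighthRoot, show (π * I / 4 : ℂ) = ((π / 4 : ℝ) : ℂ) * I by push_cast; ring,
    Complex.norm_exp_ofReal_mul_I]

lemma eighthRoot_mul_re (u : ℂ) : (eighthRoot * u).re = √2 / 2 * (u.re - u.im) := by
  rw [eighthRoot_eq]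
  simp
  ring

lemma exists_int_of_sinh_eighthRoot_mul_eq_zero {m : ℕ} (hm : m ≠ 0) {u : ℂ}
    (hu : Complex.sinh (m * (eighthRoot * u)) = 0) : ∃ n : ℤ, u = n * (π / m) * eighthRoot := by
  have hm' : (m : ℂ) ≠ 0 := by exact_mod_cast hm
  obtain ⟨n, hn⟩ := exists_int_of_sinh_eq_zero hu
  refine ⟨n, mul_left_cancel₀ (mul_ne_zero hm' eighthRoot_ne_zero) ?_⟩
  rw [mul_assoc, hn]
  field_simp
  rw [eighthRoot_sq]

lemma mul_eighthRoot_im (x : ℝ) : ((x : ℂ) * eighthRoot).im = x * (√2 / 2) := by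
  rw [eighthRoot_eq]
  simp

/-- The integrand `g(u) exp(-b u²) m sinh(ρ u) / sinh(m ρ u)`, where `ρ = exp (π i / 4)`. -/
noncomputable def mordellFun (m : ℕ) (b : ℝ) (g : ℂ → ℂ) (u : ℂ) : ℂ :=
  g u * Complex.exp (-b * u ^ 2) * sinhQuot m (eighthRoot * u)

section

variable {m : ℕ} {b : ℝ} {g : ℂ → ℂ}

lemma exists_norm_mordellFun_le (hm : m ≠ 0) (hb : 0 < b) (hg : ∀ u, ‖g u‖ ≤ 1 + ‖u‖) (Y : ℝ) :
    ∃ K X : ℝ, ∀ u : ℂ, |u.im| ≤ Y → X ≤ |u.re| → ‖mordellFun m b g u‖ ≤ K / (1 + u.re ^ 2) := by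
  obtain ⟨K, hK⟩ := exists_norm_gaussian_le hb Y
  refine ⟨K * (m * (1 + (Real.sinh 1)⁻¹)), Y + 2, fun u hY hX => ?_⟩
  rw [mordellFun, norm_mul, norm_mul]
  have h1 : 1 ≤ |(eighthRoot * u).re| := by
    rw [eighthRoot_mul_re, abs_mul, abs_of_pos (by positivity)]
    have := abs_sub_abs_le_abs_sub u.re u.im
    have h2 : 1 ≤ √2 := by rw [Real.one_le_sqrt]; norm_num
    nlinarith
  calc ‖g u‖ * ‖Complex.exp (-b * u ^ 2)‖ * ‖sinhQuot m (eighthRoot * u)‖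
      ≤ ((1 + ‖u‖) * ‖Complex.exp (-b * u ^ 2)‖) * (m * (1 + (Real.sinh 1)⁻¹)) := by
        gcongr
        · exact hg u
        · exact norm_sinhQuot_le hm one_pos h1
    _ ≤ K / (1 + u.re ^ 2) * (m * (1 + (Real.sinh 1)⁻¹)) := by
        have : 0 ≤ (Real.sinh 1)⁻¹ := inv_nonneg.2 (Real.sinh_nonneg_iff.2 zero_le_one)
        gcongr
        exact hK u hY
    _ = _ := by ring

lemma differentiableAt_mordellFun (hm : m ≠ 0) (hg : Differentiable ℂ g) {u : ℂ}
    (hu : u = 0 ∨ Complex.sinh (m * (eighthRoot * u)) ≠ 0) :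
    DifferentiableAt ℂ (mordellFun m b g) u := by
  unfold mordellFun
  have h := differentiableAt_sinhQuot hm (z := eighthRoot * u) (hu.imp (by rintro rfl; simp) id)
  have h2 : DifferentiableAt ℂ (fun u => sinhQuot m (eighthRoot * u)) u :=
    h.comp u (by fun_prop)
  have h3 : DifferentiableAt ℂ (fun u : ℂ => Complex.exp (-b * u ^ 2)) u := by fun_prop
  exact ((hg u).mul h3).mul h2

open MeasureTheory in
lemma integrable_mordellFun (hm : m ≠ 0) (hb : 0 < b) (hg : Differentiable ℂ g)
    (hg' : ∀ u, ‖g u‖ ≤ 1 + ‖u‖) {y : ℝ}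
    (hy : ∀ u : ℂ, u.im = y → u = 0 ∨ Complex.sinh (m * (eighthRoot * u)) ≠ 0) :
    Integrable fun x : ℝ => mordellFun m b g (x + y * I) := by
  obtain ⟨K, X, hK⟩ := exists_norm_mordellFun_le hm hb hg' |y|
  refine integrable_of_le_inv_one_add_sq (K := K) (X := X) ?_ fun x hx => ?_
  · refine continuous_iff_continuousAt.2 fun x => ?_
    exact ContinuousAt.comp (f := fun x : ℝ => (x : ℂ) + y * I)
      (differentiableAt_mordellFun hm hg (hy _ (by simp))).continuousAt (by fun_prop)
  · simpa using hK (x + y * I) (by simp) (by simpa using hx)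

lemma sinh_eighthRoot_mul_ne_zero (hm : m ≠ 0) {u : ℂ} (k : ℤ)
    (hu₁ : (k - 1) * (π / m * (√2 / 2)) < u.im) (hu₂ : u.im < (k + 1) * (π / m * (√2 / 2)))
    (hu : u ≠ k * (π / m) * eighthRoot) : Complex.sinh (m * (eighthRoot * u)) ≠ 0 := by
  intro h
  obtain ⟨n, rfl⟩ := exists_int_of_sinh_eighthRoot_mul_eq_zero hm h
  have hδ : 0 < π / m * (√2 / 2) := by positivity
  have him : ((n : ℂ) * (π / m) * eighthRoot).im = n * (π / m * (√2 / 2)) := by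
    have := mul_eighthRoot_im (n * (π / m))
    push_cast at this
    rw [this]
    ring
  rw [him] at hu₁ hu₂
  have h1 := lt_of_mul_lt_mul_right hu₁ hδ.le
  have h2 := lt_of_mul_lt_mul_right hu₂ hδ.le
  have h3 : n = k := by
    have h1' : k - 1 < n := by exact_mod_cast h1
    have h2' : n < k + 1 := by exact_mod_cast h2
    omega
  exact hu (by rw [h3])

/-- The lines of integration separating the poles of the integrand. -/
noncomputable def sepLine (m : ℕ) (k : ℕ) : ℝ := (k - 1 / 2) * (π / m * (√2 / 2))

lemma sinh_ne_zero_of_im_eq_sepLine (hm : m ≠ 0) (k : ℕ) {u : ℂ} (hu : u.im = sepLine m k) :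
    Complex.sinh (m * (eighthRoot * u)) ≠ 0 := by
  have hδ : 0 < π / m * (√2 / 2) := by positivity
  refine sinh_eighthRoot_mul_ne_zero hm k ?_ ?_ fun h => ?_
  · rw [hu, sepLine]; push_cast; nlinarith
  · rw [hu, sepLine]; push_cast; nlinarith
  · have := mul_eighthRoot_im (k * (π / m))
    push_cast at this h
    rw [← h, hu, sepLine] at this
    nlinarith

open MeasureTheory in
lemma integrable_mordellFun_sepLine (hm : m ≠ 0) (hb : 0 < b) (hg : Differentiable ℂ g)
    (hg' : ∀ u, ‖g u‖ ≤ 1 + ‖u‖) (k : ℕ) :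
    Integrable fun x : ℝ => mordellFun m b g (x + sepLine m k * I) :=
  integrable_mordellFun hm hb hg hg' fun _ hu => Or.inr (sinh_ne_zero_of_im_eq_sepLine hm k hu)

open MeasureTheory Set in
lemma integral_mordellFun_sepLine_succ (hm : m ≠ 0) (hb : 0 < b) (hg : Differentiable ℂ g)
    (hg' : ∀ u, ‖g u‖ ≤ 1 + ‖u‖) (k : ℕ) :
    (∫ x : ℝ, mordellFun m b g (x + sepLine m k * I)) -
      ∫ x : ℝ, mordellFun m b g (x + sepLine m (k + 1) * I) =
      2 * π * I * (g (k * (π / m) * eighthRoot) *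
        Complex.exp (-b * (k * (π / m) * eighthRoot) ^ 2) *
        (Complex.sinh (k * (π / m) * I) * (-1) ^ k) / eighthRoot) := by
  have hm' : (m : ℂ) ≠ 0 := by exact_mod_cast hm
  have hδ : 0 < π / m * (√2 / 2) := by positivity
  set w : ℂ := k * (π / m) * eighthRoot with hw
  have hwim : w.im = k * (π / m * (√2 / 2)) := by
    have := mul_eighthRoot_im (k * (π / m))
    push_cast at this
    rw [hw, this]
    ring
  have hrw : eighthRoot * w = k * (π / m) * I := by rw [hw, ← eighthRoot_sq]; ring
  have hmrw : m * (eighthRoot * w) = k * π * I := by rw [hrw]; field_simp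
  have hcosh : Complex.cosh (k * π * I) = (-1) ^ k := by
    rw [Complex.cosh_mul_I]
    have := Real.cos_nat_mul_pi k
    exact_mod_cast congrArg (Complex.ofReal) this
  have hne : ∀ u : ℂ, u.im ∈ Icc (sepLine m k) (sepLine m (k + 1)) → u ≠ w →
      Complex.sinh (m * (eighthRoot * u)) ≠ 0 := by
    intro u hu huw
    rw [mem_Icc, sepLine, sepLine] at hu
    push_cast at hu
    refine sinh_eighthRoot_mul_ne_zero hm k ?_ ?_ (by simpa [hw] using huw)
    · push_cast; nlinarith
    · push_cast; nlinarith
  have hderiv : HasDerivAt (fun u => Complex.sinh (m * (eighthRoot * u)))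
      ((-1) ^ k * (m * eighthRoot)) w := by
    have h1 : HasDerivAt (fun u : ℂ => m * (eighthRoot * u)) (m * eighthRoot) w := by
      simpa using ((hasDerivAt_id w).const_mul eighthRoot).const_mul (m : ℂ)
    have := h1.csinh
    rwa [hmrw, hcosh] at this
  have hpow : ((-1 : ℂ) ^ k) * (-1) ^ k = 1 := by rw [← mul_pow]; simp
  have hpow0 : (-1 : ℂ) ^ k ≠ 0 := by simp
  obtain ⟨K, X, hK⟩ := exists_norm_mordellFun_le hm hb hg' (max |sepLine m k| |sepLine m (k + 1)|)
  rw [integral_line_sub_integral_line_div (w := w)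
    (A := fun u => g u * Complex.exp (-b * u ^ 2) * (m * Complex.sinh (eighthRoot * u)))
    (S := fun u => Complex.sinh (m * (eighthRoot * u))) (K := K) (X := X)
    (by rw [hwim, sepLine]; nlinarith) (by rw [hwim, sepLine]; push_cast; nlinarith)
    (hg.mul (by fun_prop) |>.mul (by fun_prop)) (by fun_prop) ?_
    ?_ hne ?_ (integrable_mordellFun_sepLine hm hb hg hg' k)
    (integrable_mordellFun_sepLine hm hb hg hg' (k + 1))
    fun u hu hX => hK u (abs_le_max_abs_abs hu.1 hu.2) hX]
  · rw [hderiv.deriv, hrw]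
    congr 1
    rw [div_eq_div_iff (mul_ne_zero hpow0 (mul_ne_zero hm' eighthRoot_ne_zero)) eighthRoot_ne_zero]
    linear_combination (-(g w * Complex.exp (-b * w ^ 2) * Complex.sinh (k * (π / m) * I) *
      m * eighthRoot)) * hpow
  · simp only [hmrw]
    rw [Complex.sinh_mul_I, Complex.sin_nat_mul_pi, zero_mul]
  · rw [hderiv.deriv]
    exact mul_ne_zero hpow0 (mul_ne_zero hm' eighthRoot_ne_zero)
  · intro u hu huw
    have h := hne u hu huw
    rw [mordellFun, sinhQuot_eq m (fun h' => h (sinh_nat_mul_eq_zero h' m)), mul_div_assoc']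

open MeasureTheory in
lemma integral_mordellFun_sepLine (hm : m ≠ 0) (hb : 0 < b) (hg : Differentiable ℂ g)
    (hg' : ∀ u, ‖g u‖ ≤ 1 + ‖u‖) (n : ℕ) :
    (∫ x : ℝ, mordellFun m b g (x + sepLine m 0 * I)) -
      ∫ x : ℝ, mordellFun m b g (x + sepLine m n * I) =
      2 * π * I * ∑ k ∈ Finset.range n, (g (k * (π / m) * eighthRoot) *
        Complex.exp (-b * (k * (π / m) * eighthRoot) ^ 2) *
        (Complex.sinh (k * (π / m) * I) * (-1) ^ k) / eighthRoot) := by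
  induction n with
  | zero => simp
  | succ n ih =>
    rw [Finset.sum_range_succ, mul_add, ← ih, ← integral_mordellFun_sepLine_succ hm hb hg hg']
    ring

open MeasureTheory Set in
lemma integral_mordellFun_sepLine_zero (hm : m ≠ 0) (hb : 0 < b) (hg : Differentiable ℂ g)
    (hg' : ∀ u, ‖g u‖ ≤ 1 + ‖u‖) :
    ∫ x : ℝ, mordellFun m b g (x + sepLine m 0 * I) = ∫ x : ℝ, mordellFun m b g x := by
  have hδ : 0 < π / m * (√2 / 2) := by positivity
  have hneg : sepLine m 0 < 0 := by rw [sepLine]; push_cast; nlinarith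
  have hne : ∀ u : ℂ, u.im ∈ Icc (sepLine m 0) 0 →
      u = 0 ∨ Complex.sinh (m * (eighthRoot * u)) ≠ 0 := by
    intro u hu
    refine or_iff_not_imp_left.2 fun h0 => ?_
    rw [mem_Icc, sepLine] at hu
    refine sinh_eighthRoot_mul_ne_zero hm 0 ?_ ?_ (by simpa using h0)
    · push_cast at hu ⊢; nlinarith
    · push_cast; nlinarith
  obtain ⟨K, X, hK⟩ := exists_norm_mordellFun_le hm hb hg' |sepLine m 0|
  have := integral_line_sub_integral_line (f := mordellFun m b g) (G := mordellFun m b g) (c := 0)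
    (w := (sepLine m 0 / 2 : ℝ) * I) (y₁ := sepLine m 0) (y₂ := 0) (K := K) (X := X)
    (by simp; linarith) (by simp; linarith)
    (fun u hu => (differentiableAt_mordellFun hm hg (hne u hu)).differentiableWithinAt)
    (by simp) (integrable_mordellFun_sepLine hm hb hg hg' 0)
    (integrable_mordellFun hm hb hg hg' fun u hu => hne u (by rw [hu]; exact ⟨hneg.le, le_rfl⟩))
    fun u hu hX => hK u (by simpa using abs_le_max_abs_abs hu.1 hu.2) hX
  simpa [sub_eq_zero] using this

end

/-! ### Gaussian integrals on horizontal lines -/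

section

variable {b : ℝ}

open MeasureTheory in
lemma integrable_mul_gaussian_line (hb : 0 < b) {p : ℂ → ℂ} (hp : Continuous p)
    (hp' : ∀ u, ‖p u‖ ≤ 1 + ‖u‖) (y : ℝ) :
    Integrable fun x : ℝ => p (x + y * I) * Complex.exp (-b * (x + y * I) ^ 2) := by
  obtain ⟨K, hK⟩ := exists_norm_gaussian_le hb |y|
  refine integrable_of_le_inv_one_add_sq (K := K) (X := 0) (by fun_prop) fun x _ => ?_
  have := hK (x + y * I) (by simp)
  simp only [Complex.add_re, Complex.ofReal_re, Complex.re_ofReal_mul, Complex.I_re, mul_zero,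
    add_zero] at this
  refine le_trans ?_ this
  rw [norm_mul]
  gcongr
  exact hp' _

open MeasureTheory in
lemma integrable_gaussian_line (hb : 0 < b) (y : ℝ) :
    Integrable fun x : ℝ => Complex.exp (-b * (x + y * I) ^ 2) := by
  simpa using integrable_mul_gaussian_line hb (p := fun _ => 1) continuous_const (by simp) y

open MeasureTheory in
lemma integrable_id_mul_gaussian_line (hb : 0 < b) (y : ℝ) :
    Integrable fun x : ℝ => (x + y * I) * Complex.exp (-b * (x + y * I) ^ 2) :=
  integrable_mul_gaussian_line hb continuous_id (by simp) y

lemma integral_gaussian_line (hb : 0 < b) (y : ℝ) :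
    ∫ x : ℝ, Complex.exp (-b * (x + y * I) ^ 2) = √(π / b) := by
  rw [GaussianFourier.integral_cexp_neg_mul_sq_add_real_mul_I (by simpa using hb),
    Real.sqrt_eq_rpow, Complex.ofReal_cpow (by positivity)]
  push_cast
  rfl

open MeasureTheory in
lemma integral_id_mul_gaussian_line (hb : 0 < b) (y : ℝ) :
    ∫ x : ℝ, (x + y * I) * Complex.exp (-b * (x + y * I) ^ 2) = 0 := by
  have hd : ∀ x : ℝ, HasDerivAt (fun x : ℝ => Complex.exp (-b * (x + y * I) ^ 2))
      (-2 * b * ((x + y * I) * Complex.exp (-b * (x + y * I) ^ 2))) x := by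
    intro x
    have h1 : HasDerivAt (fun u : ℂ => Complex.exp (-b * (u + y * I) ^ 2))
        (-2 * b * ((x + y * I) * Complex.exp (-b * (x + y * I) ^ 2))) (x : ℂ) := by
      have := ((((hasDerivAt_id (x : ℂ)).add_const (y * I)).pow 2).const_mul (-b : ℂ)).cexp
      convert! this using 1
      simp
      ring
    exact h1.comp_ofReal
  have := integral_eq_zero_of_hasDerivAt_of_integrable hd
    ((integrable_id_mul_gaussian_line hb y).const_mul _) (integrable_gaussian_line hb y)
  rw [integral_const_mul] at this
  have hb' : (b : ℂ) ≠ 0 := by exact_mod_cast hb.ne'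
  simpa [hb'] using this

lemma affine_mul_gaussian_eq (hb : b ≠ 0) (a c : ℂ) (x y : ℝ) :
    (x + y * I + a) * (Complex.exp (-b * (x + y * I) ^ 2) * Complex.exp (-c * (x + y * I))) =
      Complex.exp (c ^ 2 / (4 * b)) *
        (((x + (c / (2 * b)).re : ℝ) + (y + (c / (2 * b)).im : ℝ) * I) *
          Complex.exp (-b * ((x + (c / (2 * b)).re : ℝ) + (y + (c / (2 * b)).im : ℝ) * I) ^ 2) +
        (a - c / (2 * b)) *
          Complex.exp (-b * ((x + (c / (2 * b)).re : ℝ) +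
            (y + (c / (2 * b)).im : ℝ) * I) ^ 2)) := by
  have hb' : (b : ℂ) ≠ 0 := by exact_mod_cast hb
  have h1 : (((x + (c / (2 * b)).re : ℝ) : ℂ) + (y + (c / (2 * b)).im : ℝ) * I) =
      x + y * I + c / (2 * b) := by
    conv_rhs => rw [← Complex.re_add_im (c / (2 * b))]
    push_cast
    ring
  rw [h1, ← add_mul, mul_left_comm (Complex.exp (c ^ 2 / (4 * b))), ← Complex.exp_add,
    ← Complex.exp_add]
  congr 1
  · ring
  · congr 1
    field_simp
    ring

open MeasureTheory in
lemma integrable_affine_mul_gaussian (hb : 0 < b) (a c : ℂ) (y : ℝ) :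
    Integrable fun x : ℝ => (x + y * I + a) *
      (Complex.exp (-b * (x + y * I) ^ 2) * Complex.exp (-c * (x + y * I))) := by
  simp only [affine_mul_gaussian_eq hb.ne' a c _ y]
  exact ((((integrable_id_mul_gaussian_line hb (y + (c / (2 * b)).im)).add
    ((integrable_gaussian_line hb (y + (c / (2 * b)).im)).const_mul
      (a - c / (2 * b)))).comp_add_right (c / (2 * b)).re).const_mul _)

open MeasureTheory in
lemma integral_affine_mul_gaussian (hb : 0 < b) (a c : ℂ) (y : ℝ) :
    ∫ x : ℝ, (x + y * I + a) *
      (Complex.exp (-b * (x + y * I) ^ 2) * Complex.exp (-c * (x + y * I))) =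
      √(π / b) * ((a - c / (2 * b)) * Complex.exp (c ^ 2 / (4 * b))) := by
  simp only [affine_mul_gaussian_eq hb.ne' a c _ y]
  rw [integral_const_mul, integral_add_right_eq_self fun x : ℝ =>
    ((x + (y + (c / (2 * b)).im : ℝ) * I) *
      Complex.exp (-b * (x + (y + (c / (2 * b)).im : ℝ) * I) ^ 2) +
    (a - c / (2 * b)) * Complex.exp (-b * (x + (y + (c / (2 * b)).im : ℝ) * I) ^ 2)),
    integral_add (integrable_id_mul_gaussian_line hb _)
      ((integrable_gaussian_line hb _).const_mul _), integral_id_mul_gaussian_line hb,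
    integral_const_mul, integral_gaussian_line hb]
  ring

end

lemma sinhQuot_mul_one_sub_exp {m : ℕ} {z : ℂ} (hz : Complex.sinh (m * z) ≠ 0) (N : ℕ) :
    sinhQuot m z * (1 - Complex.exp (-(2 * m * N * z))) =
      m * ∑ r ∈ Finset.range N, (Complex.exp (-((2 * m * r + m - 1) * z)) -
        Complex.exp (-((2 * m * r + m + 1) * z))) := by
  rw [sinhQuot_eq m fun h => hz (sinh_nat_mul_eq_zero h m), div_mul_eq_mul_div,
    div_eq_iff hz, mul_assoc, mul_assoc (m : ℂ)]
  congr 1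
  have h : ∀ r ∈ Finset.range N, (Complex.exp (-((2 * m * r + m - 1) * z)) -
      Complex.exp (-((2 * m * r + m + 1) * z))) * Complex.sinh (m * z) =
      Complex.sinh z * Complex.exp (-(2 * m * r * z)) -
        Complex.sinh z * Complex.exp (-(2 * m * (r + 1 : ℕ) * z)) := by
    intro r _
    simp only [Complex.sinh, mul_div_assoc', div_mul_eq_mul_div, sub_mul, mul_sub,
      ← Complex.exp_add, ← sub_div]
    congr 1
    congr 3 <;> push_cast <;> ring
  rw [Finset.sum_mul, Finset.sum_congr rfl h,
    Finset.sum_range_sub' fun r : ℕ => Complex.sinh z * Complex.exp (-(2 * m * (r : ℂ) * z))]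
  simp
  ring

/-! ### The exact evaluation of the Mordell-type integral -/

section

variable {m N : ℕ}

lemma mordellFun_id_add (hm : m ≠ 0) (N : ℕ) (u : ℂ) :
    mordellFun m (m * N / (2 * π)) id (u + 2 * π * eighthRoot) =
      (u + 2 * π * eighthRoot) * Complex.exp (-(m * N / (2 * π) : ℝ) * u ^ 2) *
        Complex.exp (-(2 * m * N * (eighthRoot * u))) * sinhQuot m (eighthRoot * u) := by
  have hpi : (π : ℂ) ≠ 0 := by exact_mod_cast Real.pi_ne_zero
  rw [mordellFun, mul_add, show eighthRoot * (2 * π * eighthRoot) = 2 * π * I by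
    rw [← eighthRoot_sq]; ring, sinhQuot_add, id, mul_assoc _ (Complex.exp _) (Complex.exp _),
    ← Complex.exp_add]
  congr 2
  refine Complex.exp_eq_exp_iff_exists_int.2 ⟨-(m * N), ?_⟩
  push_cast
  field_simp
  linear_combination (-(4 * N * π ^ 2) : ℂ) * eighthRoot_sq

lemma mordellFun_id_sub (hm : m ≠ 0) (N : ℕ) {u : ℂ}
    (hu : Complex.sinh (m * (eighthRoot * u)) ≠ 0) :
    mordellFun m (m * N / (2 * π)) id u -
        mordellFun m (m * N / (2 * π)) id (u + 2 * π * eighthRoot) +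
        2 * π * eighthRoot * mordellFun m (m * N / (2 * π)) (fun _ => 1) u =
      m * ∑ r ∈ Finset.range N,
        ((u + 2 * π * eighthRoot) * (Complex.exp (-(m * N / (2 * π) : ℝ) * u ^ 2) *
            Complex.exp (-((2 * m * r + m - 1) * eighthRoot) * u)) -
          (u + 2 * π * eighthRoot) * (Complex.exp (-(m * N / (2 * π) : ℝ) * u ^ 2) *
            Complex.exp (-((2 * m * r + m + 1) * eighthRoot) * u))) := by
  have h := sinhQuot_mul_one_sub_exp hu N
  have h2 : ∀ c : ℂ, -(c * eighthRoot) * u = -(c * (eighthRoot * u)) := fun c => by ring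
  simp only [h2, ← mul_sub]
  rw [← Finset.mul_sum, ← Finset.mul_sum, mul_left_comm (m : ℂ), mul_left_comm (m : ℂ), ← h,
    mordellFun_id_add hm]
  simp only [mordellFun, id]
  ring

lemma exp_sq_div_eq_quadPhase (hm : m ≠ 0) (hN : N ≠ 0) (n : ℂ) :
    Complex.exp ((n * eighthRoot) ^ 2 / (4 * (m * N / (2 * π) : ℝ))) = quadPhase m N n := by
  have hpi : (π : ℂ) ≠ 0 := by exact_mod_cast Real.pi_ne_zero
  have hm' : (m : ℂ) ≠ 0 := by exact_mod_cast hm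
  have hN' : (N : ℂ) ≠ 0 := by exact_mod_cast hN
  rw [quadPhase, mul_pow, eighthRoot_sq]
  congr 1
  push_cast
  field_simp
  ring

lemma sum_residues_eq {R : ℕ → ℂ} (h0 : R m = 0) (h : ∀ k ≤ 2 * m, R (2 * m - k) = -R k) :
    ∑ k ∈ Finset.range (2 * m), k * R k = 2 * ∑ k ∈ Finset.Icc 1 (m - 1), (k - m) * R k := by
  rcases Nat.eq_zero_or_pos m with rfl | hm
  · simp
  have e1 : ∑ k ∈ Finset.range (2 * m), (k : ℂ) * R k =
      ∑ k ∈ Finset.range m, (k : ℂ) * R k +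
        ∑ k ∈ Finset.range m, ((k + 1 : ℂ) - 2 * m) * R (k + 1) := by
    rw [two_mul, Finset.sum_range_add, add_right_inj, ← Finset.sum_range_reflect]
    refine Finset.sum_congr rfl fun j hj => ?_
    have hj' := Finset.mem_range.1 hj
    have h1 := h (j + 1) (by omega)
    rw [show m + (m - 1 - j) = 2 * m - (j + 1) by omega, h1, Nat.cast_sub (by omega)]
    push_cast
    ring
  have e2 : ∑ k ∈ Finset.range m, ((k + 1 : ℂ) - 2 * m) * R (k + 1) =
      ∑ k ∈ Finset.Icc 1 (m - 1), ((k : ℂ) - 2 * m) * R k := by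
    obtain ⟨n, rfl⟩ := Nat.exists_eq_succ_of_ne_zero hm.ne'
    rw [Finset.sum_range_succ, Nat.succ_eq_add_one, h0, mul_zero, add_zero, Nat.add_sub_cancel,
      ← Finset.Ico_add_one_right_eq_Icc, Finset.sum_Ico_eq_sum_range]
    refine Finset.sum_congr rfl fun j _ => ?_
    rw [add_comm 1 j]
    push_cast
    ring
  have e3 : ∑ k ∈ Finset.range m, (k : ℂ) * R k = ∑ k ∈ Finset.Icc 1 (m - 1), (k : ℂ) * R k := by
    obtain ⟨n, rfl⟩ := Nat.exists_eq_succ_of_ne_zero hm.ne'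
    rw [Finset.sum_range_succ', Nat.succ_eq_add_one, Nat.add_sub_cancel,
      ← Finset.Ico_add_one_right_eq_Icc, Finset.sum_Ico_eq_sum_range]
    simp [add_comm]
  rw [e1, e2, e3, ← Finset.sum_add_distrib, Finset.mul_sum]
  exact Finset.sum_congr rfl fun k _ => by ring

/-- The coefficient of the residue of the Mordell-type integrand at its `k`-th pole. -/
noncomputable def poleCoeff (m N k : ℕ) : ℂ :=
  (-1) ^ k * (Real.sin (k * π / m) : ℂ) * Complex.exp (-(k ^ 2) * π * I * N / (2 * m))

lemma poleCoeff_reflect (hm : m ≠ 0) (N : ℕ) {k : ℕ} (hk : k ≤ 2 * m) :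
    poleCoeff m N (2 * m - k) = -poleCoeff m N k := by
  have hm' : (m : ℂ) ≠ 0 := by exact_mod_cast hm
  have hmR : (m : ℝ) ≠ 0 := by exact_mod_cast hm
  have hsin : Real.sin ((2 * m - k : ℕ) * π / m) = -Real.sin (k * π / m) := by
    rw [Nat.cast_sub hk, ← Real.sin_two_pi_sub]
    congr 1
    push_cast
    field_simp
  have hpow : (-1 : ℂ) ^ (2 * m - k) = (-1) ^ k := by
    have h1 : (-1 : ℂ) ^ (2 * m - k) * (-1) ^ k = 1 := by
      rw [← pow_add, Nat.sub_add_cancel hk, pow_mul]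
      simp
    have h2 : (-1 : ℂ) ^ k * (-1) ^ k = 1 := by rw [← mul_pow]; simp
    exact mul_right_cancel₀ (by simp : (-1 : ℂ) ^ k ≠ 0) (h1.trans h2.symm)
  have hexp : Complex.exp (-((2 * m - k : ℕ) ^ 2) * π * I * N / (2 * m)) =
      Complex.exp (-(k ^ 2) * π * I * N / (2 * m)) := by
    refine Complex.exp_eq_exp_iff_exists_int.2 ⟨(k - m) * N, ?_⟩
    rw [Nat.cast_sub hk]
    push_cast
    field_simp
    ring
  rw [poleCoeff, poleCoeff, hsin, hpow, hexp]
  push_cast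
  ring

lemma poleCoeff_self (hm : m ≠ 0) (N : ℕ) : poleCoeff m N m = 0 := by
  have hmR : (m : ℝ) ≠ 0 := by exact_mod_cast hm
  rw [poleCoeff, mul_div_cancel_left₀ _ hmR, Real.sin_pi]
  simp

open MeasureTheory in
lemma integral_mordellFun_id_sub (hm : m ≠ 0) (hN : N ≠ 0) :
    (∫ x : ℝ, mordellFun m (m * N / (2 * π)) id (x + sepLine m 0 * I)) -
      ∫ x : ℝ, mordellFun m (m * N / (2 * π)) id (x + sepLine m (2 * m) * I) =
      -(4 * π ^ 2 / m) * ∑ k ∈ Finset.Icc 1 (m - 1), (k - m) * poleCoeff m N k := by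
  have hpi : (π : ℂ) ≠ 0 := by exact_mod_cast Real.pi_ne_zero
  have hm' : (m : ℂ) ≠ 0 := by exact_mod_cast hm
  rw [integral_mordellFun_sepLine hm (by positivity) differentiable_id (by simp)]
  have h : ∀ k ∈ Finset.range (2 * m), id (k * (π / m) * eighthRoot) *
      Complex.exp (-(m * N / (2 * π) : ℝ) * (k * (π / m) * eighthRoot) ^ 2) *
        (Complex.sinh (k * (π / m) * I) * (-1) ^ k) / eighthRoot =
      π * I / m * (k * poleCoeff m N k) := by
    intro k _
    have h1 : Complex.exp (-(m * N / (2 * π) : ℝ) * (k * (π / m) * eighthRoot) ^ 2) =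
        Complex.exp (-(k ^ 2) * π * I * N / (2 * m)) := by
      rw [mul_pow, eighthRoot_sq]
      congr 1
      push_cast
      field_simp
    have h2 : Complex.sinh (k * (π / m) * I) = (Real.sin (k * π / m) : ℂ) * I := by
      rw [Complex.sinh_mul_I]
      push_cast
      rw [mul_div_assoc]
    have := eighthRoot_ne_zero
    rw [h1, h2, poleCoeff, id, div_eq_iff this]
    ring
  rw [Finset.sum_congr rfl h, ← Finset.mul_sum, sum_residues_eq (poleCoeff_self hm N)
    fun k hk => poleCoeff_reflect hm N hk]
  field_simp
  linear_combination (4 * ∑ k ∈ Finset.Icc 1 (m - 1), ((k : ℂ) - m) * poleCoeff m N k) *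
    Complex.I_sq

open MeasureTheory in
lemma integral_mordellFun_one (hm : m ≠ 0) (hN : N ≠ 0) :
    2 * π * eighthRoot * ∫ x : ℝ, mordellFun m (m * N / (2 * π)) (fun _ => 1) x =
      2 * π * eighthRoot * √(π / (m * N / (2 * π))) *
        (1 / (2 * N) * ∑ r ∈ Finset.range N,
        ((2 * m * r + m + 1) * quadPhase m N (2 * m * r + m + 1) -
          (2 * m * r + m - 1) * quadPhase m N (2 * m * r + m - 1))) +
      4 * π ^ 2 / m * ∑ k ∈ Finset.Icc 1 (m - 1), (k - m) * poleCoeff m N k := by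
  have hpi : (π : ℂ) ≠ 0 := by exact_mod_cast Real.pi_ne_zero
  have hm' : (m : ℂ) ≠ 0 := by exact_mod_cast hm
  have hN' : (N : ℂ) ≠ 0 := by exact_mod_cast hN
  have hres := integral_mordellFun_id_sub hm hN
  have hquad := sum_quadPhase_eq hm hN
  have hexp := exp_sq_div_eq_quadPhase hm hN
  have hadd {u : ℂ} (hu : Complex.sinh (m * (eighthRoot * u)) ≠ 0) := mordellFun_id_sub hm N hu
  have hb : (0 : ℝ) < m * N / (2 * π) := by positivity
  have hbe : ((m * N / (2 * π) : ℝ) : ℂ) = m * N / (2 * π) := by push_cast; rfl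
  set b : ℝ := m * N / (2 * π) with hbdef
  have hintg := integrable_mordellFun_sepLine hm hb differentiable_id (by simp)
  have hint1 := integrable_mordellFun_sepLine hm hb (g := fun _ => 1) (by fun_prop) (by simp) 0
  have hshift : ∀ x : ℝ, mordellFun m b id (x + sepLine m 0 * I + 2 * π * eighthRoot) =
      mordellFun m b id ((x + √2 * π : ℝ) + sepLine m (2 * m) * I) := by
    intro x
    congr 1
    rw [eighthRoot_eq, sepLine, sepLine]
    push_cast
    field_simp
    ring
  have hintshift : Integrable fun x : ℝ =>
      mordellFun m b id (x + sepLine m 0 * I + 2 * π * eighthRoot) := by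
    simp only [hshift]
    exact (hintg (2 * m)).comp_add_right (√2 * π)
  have hsub : Integrable fun x : ℝ => mordellFun m b id (x + sepLine m 0 * I) -
      mordellFun m b id (x + sepLine m 0 * I + 2 * π * eighthRoot) := (hintg 0).sub hintshift
  have h1 : ∫ x : ℝ, mordellFun m b id (x + sepLine m 0 * I + 2 * π * eighthRoot) =
      ∫ x : ℝ, mordellFun m b id (x + sepLine m (2 * m) * I) := by
    simp only [hshift]
    exact integral_add_right_eq_self (fun x : ℝ => mordellFun m b id (x + sepLine m (2 * m) * I)) _
  have h2 : (∫ x : ℝ, mordellFun m b id (x + sepLine m 0 * I)) -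
      (∫ x : ℝ, mordellFun m b id (x + sepLine m (2 * m) * I)) +
      2 * π * eighthRoot * (∫ x : ℝ, mordellFun m b (fun _ => 1) (x + sepLine m 0 * I)) =
      m * ∑ r ∈ Finset.range N,
        (√(π / b) * ((2 * π * eighthRoot - (2 * m * r + m - 1) * eighthRoot / (2 * b)) *
          quadPhase m N (2 * m * r + m - 1)) -
        √(π / b) * ((2 * π * eighthRoot - (2 * m * r + m + 1) * eighthRoot / (2 * b)) *
          quadPhase m N (2 * m * r + m + 1))) := by
    rw [← h1, ← integral_sub (hintg 0) hintshift, ← integral_const_mul,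
      ← integral_add hsub (hint1.const_mul _)]
    rw [integral_congr_ae (Filter.Eventually.of_forall fun x =>
      hadd (sinh_ne_zero_of_im_eq_sepLine hm 0 (by simp)))]
    rw [integral_const_mul, integral_finsetSum]
    · congr 1
      refine Finset.sum_congr rfl fun r _ => ?_
      rw [integral_sub (integrable_affine_mul_gaussian hb _ _ _)
        (integrable_affine_mul_gaussian hb _ _ _), integral_affine_mul_gaussian hb,
        integral_affine_mul_gaussian hb, hexp, hexp]
    · exact fun r _ => (integrable_affine_mul_gaussian hb _ _ _).sub
        (integrable_affine_mul_gaussian hb _ _ _)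
  rw [hres, integral_mordellFun_sepLine_zero hm hb (by fun_prop) (by simp)] at h2
  have h3 : ∑ r ∈ Finset.range N,
        (√(π / b) * ((2 * π * eighthRoot - (2 * m * r + m - 1) * eighthRoot / (2 * b)) *
          quadPhase m N (2 * m * r + m - 1)) -
        √(π / b) * ((2 * π * eighthRoot - (2 * m * r + m + 1) * eighthRoot / (2 * b)) *
          quadPhase m N (2 * m * r + m + 1))) =
      (√(π / b) * eighthRoot / (2 * b)) * ∑ r ∈ Finset.range N,
        ((2 * m * r + m + 1) * quadPhase m N (2 * m * r + m + 1) -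
          (2 * m * r + m - 1) * quadPhase m N (2 * m * r + m - 1)) := by
    rw [← sub_eq_zero, Finset.mul_sum, ← Finset.sum_sub_distrib]
    have h4 := congrArg (fun t => 2 * π * eighthRoot * √(π / b) * t) (sub_eq_zero.2 hquad)
    rw [mul_zero, ← Finset.sum_sub_distrib, Finset.mul_sum] at h4
    rw [← h4]
    exact Finset.sum_congr rfl fun r _ => by ring
  rw [h3] at h2
  have hmb : (m : ℂ) / (2 * b) = π / N := by
    rw [hbe]
    field_simp
  linear_combination h2 + √(π / b) * eighthRoot * (∑ r ∈ Finset.range N,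
        ((2 * m * r + m + 1) * quadPhase m N (2 * m * r + m + 1) -
          (2 * m * r + m - 1) * quadPhase m N (2 * m * r + m - 1))) * hmb

end

/-! ### Asymptotic expansion of the Mordell-type integral -/

section

variable {b : ℝ}

open MeasureTheory in
lemma integrable_pow_mul_gaussian (hb : 0 < b) (n : ℕ) :
    Integrable fun x : ℝ => x ^ n * Real.exp (-b * x ^ 2) := by
  have := integrable_rpow_mul_exp_neg_mul_sq hb (s := n)
    (neg_one_lt_zero.trans_le (Nat.cast_nonneg n))
  simpa only [Real.rpow_natCast] using this

open MeasureTheory in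
lemma integral_even_pow_mul_gaussian (hb : 0 < b) (k : ℕ) :
    ∫ x : ℝ, x ^ (2 * k) * Real.exp (-b * x ^ 2) =
      √(π / b) * ((2 * k).factorial / (4 ^ k * k.factorial * b ^ k)) := by
  induction k with
  | zero => simpa using integral_gaussian b
  | succ k ih =>
    have hd : ∀ x : ℝ, HasDerivAt (fun x : ℝ => x ^ (2 * k + 1) * Real.exp (-b * x ^ 2))
        ((2 * k + 1) * (x ^ (2 * k) * Real.exp (-b * x ^ 2)) -
          2 * b * (x ^ (2 * (k + 1)) * Real.exp (-b * x ^ 2))) x := by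
      intro x
      have h1 := (((hasDerivAt_pow 2 x).const_mul (-b)).exp)
      convert! (hasDerivAt_pow (2 * k + 1) x).mul h1 using 1
      push_cast
      ring
    have hi := (integrable_pow_mul_gaussian hb (2 * k)).const_mul (2 * k + 1)
    have hi' := (integrable_pow_mul_gaussian hb (2 * (k + 1))).const_mul (2 * b)
    have h0 := integral_eq_zero_of_hasDerivAt_of_integrable hd (hi.sub hi')
      (integrable_pow_mul_gaussian hb (2 * k + 1))
    rw [integral_sub hi hi', integral_const_mul, integral_const_mul, ih] at h0
    refine mul_left_cancel₀ (mul_ne_zero two_ne_zero hb.ne') ?_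
    rw [← sub_eq_zero.1 h0, show 2 * (k + 1) = 2 * k + 1 + 1 by ring,
      Nat.factorial_succ (2 * k + 1),
      Nat.factorial_succ (2 * k), Nat.factorial_succ k]
    push_cast
    field_simp
    ring

end

lemma exists_norm_sub_sum_le {m : ℕ} (hm : m ≠ 0) {E : ℕ → ℂ}
    (hE : ∀ z : ℂ, z ≠ 0 → ‖z‖ < π / m →
      HasSum (fun k : ℕ => E k * z ^ (2 * k) / ((2 * k).factorial : ℂ))
        ((m : ℂ) * Complex.sinh z / Complex.sinh (m * z))) (K : ℕ) :
    ∃ C : ℝ, ∀ x : ℝ, x ≠ 0 →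
      ‖sinhQuot m (eighthRoot * x) -
        ∑ k ∈ Finset.range K, E k * (eighthRoot * x) ^ (2 * k) / ((2 * k).factorial : ℂ)‖ ≤
          C * x ^ (2 * K) := by
  have hm0 : (0 : ℝ) < m := by exact_mod_cast Nat.pos_of_ne_zero hm
  have hpm : 0 < π / m := by positivity
  obtain ⟨r, hr0, hrlt⟩ : ∃ r : ℝ, 0 < r ∧ r < π / m :=
    ⟨π / m / 2, by positivity, half_lt_self hpm⟩
  set a : ℕ → ℝ := fun k => ‖E k‖ * r ^ (2 * k) / (2 * k).factorial with ha
  have hterm : ∀ (x : ℝ) (k : ℕ),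
      ‖E k * (eighthRoot * x) ^ (2 * k) / ((2 * k).factorial : ℂ)‖ = a k * (x / r) ^ (2 * k) := by
    intro x k
    rw [norm_div, norm_mul, norm_pow, norm_mul, norm_eighthRoot, one_mul, Complex.norm_natCast,
      Complex.norm_real, Real.norm_eq_abs, pow_mul, sq_abs, ← pow_mul, ha, div_pow]
    field_simp
  have hasum : Summable a := by
    have h := (hE r (by exact_mod_cast hr0.ne') (by
      rw [Complex.norm_real, Real.norm_of_nonneg hr0.le]; exact hrlt)).summable.norm
    refine h.congr fun k => ?_
    rw [norm_div, norm_mul, norm_pow, Complex.norm_natCast, Complex.norm_real,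
      Real.norm_of_nonneg hr0.le]
  have ha0 : ∀ k, 0 ≤ a k := fun k => by positivity
  set M : ℝ := m * (1 + (Real.sinh (√2 / 2 * r))⁻¹) with hM
  have hM0 : 0 ≤ M := by
    have : 0 ≤ Real.sinh (√2 / 2 * r) := Real.sinh_nonneg_iff.2 (by positivity)
    positivity
  refine ⟨(∑' k, a k + M) / r ^ (2 * K), fun x hx => ?_⟩
  have hrhs : (∑' k, a k + M) / r ^ (2 * K) * x ^ (2 * K) =
      (∑' k, a k) * (x / r) ^ (2 * K) + M * (x / r) ^ (2 * K) := by
    rw [div_pow, add_div, add_mul, div_mul_eq_mul_div, div_mul_eq_mul_div, mul_div_assoc,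
      mul_div_assoc]
  rw [hrhs]
  have hpow : ∀ n : ℕ, (x / r) ^ (2 * n) = (|x| / r) ^ (2 * n) := fun n => by
    rw [div_pow, div_pow, pow_mul |x|, sq_abs, ← pow_mul]
  simp only [hpow]
  rcases le_or_gt |x| r with hxr | hxr
  · have hle : |x| / r ≤ 1 := (div_le_one hr0).2 hxr
    have hz : Complex.sinh (m * (eighthRoot * x)) ≠ 0 := by
      refine sinh_eighthRoot_mul_ne_zero hm 0 ?_ ?_ (by simpa using hx) <;> simp <;> positivity
    rw [sinhQuot_eq m fun h => hz (sinh_nat_mul_eq_zero h m)]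
    have h1 := hE (eighthRoot * x) (mul_ne_zero eighthRoot_ne_zero (by exact_mod_cast hx)) (by
      rw [norm_mul, norm_eighthRoot, one_mul, Complex.norm_real, Real.norm_eq_abs]
      exact hxr.trans_lt hrlt)
    have h2 := (hasSum_nat_add_iff' K).2 h1
    have h3 := ((summable_nat_add_iff K).2 hasum).hasSum.mul_right ((|x| / r) ^ (2 * K))
    refine (h2.norm_le_of_bounded h3 fun k => ?_).trans ?_
    · rw [hterm, hpow]
      refine mul_le_mul_of_nonneg_left ?_ (ha0 _)
      exact pow_le_pow_of_le_one (by positivity) hle (show 2 * K ≤ 2 * (k + K) by omega)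
    · have h4 : ∑' k, a (k + K) ≤ ∑' k, a k := by
        rw [← hasum.sum_add_tsum_nat_add K]
        exact le_add_of_nonneg_left (Finset.sum_nonneg fun k _ => ha0 k)
      have h5 : 0 ≤ M * (|x| / r) ^ (2 * K) := by positivity
      have h6 : (∑' k, a (k + K)) * (|x| / r) ^ (2 * K) ≤ (∑' k, a k) * (|x| / r) ^ (2 * K) := by
        gcongr
      linarith
  · have hle : 1 ≤ |x| / r := (one_le_div hr0).2 hxr.le
    have h1 : ‖sinhQuot m (eighthRoot * x)‖ ≤ M * (|x| / r) ^ (2 * K) := by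
      refine (norm_sinhQuot_le hm (ε := √2 / 2 * r) (by positivity) ?_).trans
        (le_mul_of_one_le_right hM0 (one_le_pow₀ hle))
      rw [eighthRoot_mul_re, Complex.ofReal_re, Complex.ofReal_im, sub_zero, abs_mul,
        abs_of_pos (by positivity : 0 < √2 / 2)]
      gcongr
    have h2 : ‖∑ k ∈ Finset.range K, E k * (eighthRoot * x) ^ (2 * k) / ((2 * k).factorial : ℂ)‖ ≤
        (∑' k, a k) * (|x| / r) ^ (2 * K) := by
      calc _ ≤ ∑ k ∈ Finset.range K, a k * (|x| / r) ^ (2 * K) := by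
            refine norm_sum_le_of_le _ fun k hk => ?_
            rw [hterm, hpow]
            refine mul_le_mul_of_nonneg_left ?_ (ha0 _)
            exact pow_le_pow_right₀ hle (Nat.mul_le_mul_left 2 (Finset.mem_range.1 hk).le)
        _ ≤ _ := by
            rw [← Finset.sum_mul]
            gcongr
            exact hasum.sum_le_tsum _ fun k _ => ha0 k
    exact (norm_sub_le _ _).trans (by linarith)

open MeasureTheory in
lemma exists_norm_integral_mordellFun_sub_le {m : ℕ} (hm : m ≠ 0) {E : ℕ → ℂ}
    (hE : ∀ z : ℂ, z ≠ 0 → ‖z‖ < π / m →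
      HasSum (fun k : ℕ => E k * z ^ (2 * k) / ((2 * k).factorial : ℂ))
        ((m : ℂ) * Complex.sinh z / Complex.sinh (m * z))) (K : ℕ) :
    ∃ C : ℝ, ∀ b : ℝ, 0 < b →
      ‖(√(π / b) : ℂ)⁻¹ * (∫ x : ℝ, mordellFun m b (fun _ => 1) x) -
        ∑ k ∈ Finset.range K, E k / (k.factorial : ℂ) * (I / (4 * b)) ^ k‖ ≤ C / b ^ K := by
  obtain ⟨C, hC⟩ := exists_norm_sub_sum_le hm hE K
  refine ⟨C * ((2 * K).factorial / (4 ^ K * K.factorial)), fun b hb => ?_⟩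
  have hs : 0 < √(π / b) := by positivity
  have hs' : (√(π / b) : ℂ) ≠ 0 := by exact_mod_cast hs.ne'
  have hb' : (b : ℂ) ≠ 0 := by exact_mod_cast hb.ne'
  have hterm : ∀ (k : ℕ) (x : ℝ), Complex.exp (-b * x ^ 2) *
      (E k * (eighthRoot * x) ^ (2 * k) / ((2 * k).factorial : ℂ)) =
      E k * I ^ k / ((2 * k).factorial : ℂ) * ((x ^ (2 * k) * Real.exp (-b * x ^ 2) : ℝ) : ℂ) := by
    intro k x
    rw [mul_pow, pow_mul eighthRoot, eighthRoot_sq]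
    push_cast
    ring
  have hmom : ∀ k : ℕ, Integrable fun x : ℝ => Complex.exp (-b * x ^ 2) *
      (E k * (eighthRoot * x) ^ (2 * k) / ((2 * k).factorial : ℂ)) := by
    intro k
    simp only [hterm]
    exact ((integrable_pow_mul_gaussian hb (2 * k)).ofReal).const_mul _
  have hval : ∀ k : ℕ, ∫ x : ℝ, Complex.exp (-b * x ^ 2) *
      (E k * (eighthRoot * x) ^ (2 * k) / ((2 * k).factorial : ℂ)) =
      √(π / b) * (E k / (k.factorial : ℂ) * (I / (4 * b)) ^ k) := by
    intro k
    simp only [hterm]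
    rw [integral_const_mul, integral_complex_ofReal, integral_even_pow_mul_gaussian hb]
    have h1 : ((2 * k).factorial : ℂ) ≠ 0 := by exact_mod_cast Nat.factorial_ne_zero _
    have h2 : (k.factorial : ℂ) ≠ 0 := by exact_mod_cast Nat.factorial_ne_zero _
    push_cast
    rw [div_pow, mul_pow]
    field_simp
  have hintg : Integrable fun x : ℝ => mordellFun m b (fun _ => 1) x := by
    have := integrable_mordellFun hm hb (g := fun _ => 1) (by fun_prop) (by simp) (y := 0)
      fun u hu => or_iff_not_imp_left.2 fun h0 => by
        refine sinh_eighthRoot_mul_ne_zero hm 0 ?_ ?_ (by simpa using h0) <;> rw [hu] <;> simp <;>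
          positivity
    simpa using this
  have hsum := integrable_finsetSum (Finset.range K) fun k _ => hmom k
  have hdiff : (∫ x : ℝ, mordellFun m b (fun _ => 1) x) -
      √(π / b) * ∑ k ∈ Finset.range K, E k / (k.factorial : ℂ) * (I / (4 * b)) ^ k =
      ∫ x : ℝ, Complex.exp (-b * x ^ 2) * (sinhQuot m (eighthRoot * x) -
        ∑ k ∈ Finset.range K, E k * (eighthRoot * x) ^ (2 * k) / ((2 * k).factorial : ℂ)) := by
    simp only [mul_sub, Finset.mul_sum]
    simp only [mordellFun, one_mul] at hintg ⊢
    rw [integral_sub hintg hsum, integral_finsetSum _ fun k _ => hmom k]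
    simp only [hval]
  have hbound : ‖∫ x : ℝ, Complex.exp (-b * x ^ 2) * (sinhQuot m (eighthRoot * x) -
        ∑ k ∈ Finset.range K, E k * (eighthRoot * x) ^ (2 * k) / ((2 * k).factorial : ℂ))‖ ≤
      C * (√(π / b) * ((2 * K).factorial / (4 ^ K * K.factorial * b ^ K))) := by
    rw [← integral_even_pow_mul_gaussian hb, ← integral_const_mul]
    refine norm_integral_le_of_norm_le ((integrable_pow_mul_gaussian hb (2 * K)).const_mul C) ?_
    filter_upwards [compl_mem_ae_iff.2 (measure_singleton (0 : ℝ))] with x hx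
    have : ‖Complex.exp (-b * x ^ 2)‖ = Real.exp (-b * x ^ 2) := by
      rw [← Complex.ofReal_neg, ← Complex.ofReal_pow, ← Complex.ofReal_mul,
        Complex.norm_exp_ofReal]
    rw [norm_mul, this]
    nlinarith [mul_le_mul_of_nonneg_left (hC x hx) (Real.exp_pos (-b * x ^ 2)).le]
  rw [← hdiff] at hbound
  have hfac : (√(π / b) : ℂ)⁻¹ * (∫ x : ℝ, mordellFun m b (fun _ => 1) x) -
        ∑ k ∈ Finset.range K, E k / (k.factorial : ℂ) * (I / (4 * b)) ^ k =
      (√(π / b) : ℂ)⁻¹ * ((∫ x : ℝ, mordellFun m b (fun _ => 1) x) -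
      √(π / b) * ∑ k ∈ Finset.range K, E k / (k.factorial : ℂ) * (I / (4 * b)) ^ k) := by
    rw [mul_sub, inv_mul_cancel_left₀ hs']
  rw [hfac, norm_mul, norm_inv, Complex.norm_real, Real.norm_of_nonneg hs.le, inv_mul_le_iff₀ hs]
  refine hbound.trans_eq ?_
  field_simp
/-- asymptotic expansion of `S_m(N)` for `m ≥ 2`.  Here `E k` are the
numbers `E_k^{(m;0)}` defined by the Taylor expansion
`m sinh z / sinh (mz) = Σ_k E_k z^{2k}/(2k)!` near `z = 0`: for every `K` there is a
constant `C_K` with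
`|S_m(N) − √N e^{3πi/4 − (m−1)²πi/(2mN)} √(2/m)
   Σ_{k=1}^{m−1} (−1)^k (k−m) sin(kπ/m) e^{−k²πiN/(2m)}
 − e^{−(m−1)²πi/(2mN)} Σ_{k=0}^{K−1} (E_k/k!)(πi/(2mN))^k| ≤ C_K N^{−K}` for `N ≥ 1`. -/
theorem stmt2 (m p : ℕ) (hm : m = p + 2) (E : ℕ → ℂ)
    (hE : ∀ z : ℂ, z ≠ 0 → ‖z‖ < π / m →
      HasSum (fun k : ℕ => E k * z ^ (2 * k) / ((2 * k).factorial : ℂ))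
        ((m : ℂ) * Complex.sinh z / Complex.sinh (m * z))) :
    ∀ K : ℕ, ∃ C : ℝ, ∀ N : ℕ, 1 ≤ N →
      ‖kashaevSum p N -
          (Real.sqrt N : ℂ) *
            Complex.exp (3 * (π : ℂ) * I / 4 -
              ((m : ℂ) - 1) ^ 2 * (π : ℂ) * I / (2 * m * N)) *
            (Real.sqrt (2 / m) : ℂ) *
            ∑ k ∈ Finset.Icc 1 (m - 1),
              (-1 : ℂ) ^ k * ((k : ℂ) - m) * (Real.sin (k * π / m) : ℂ) *
                Complex.exp (-((k : ℂ) ^ 2) * (π : ℂ) * I * N / (2 * m)) -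
          Complex.exp (-(((m : ℂ) - 1) ^ 2) * (π : ℂ) * I / (2 * m * N)) *
            ∑ k ∈ Finset.range K,
              E k / (k.factorial : ℂ) * ((π : ℂ) * I / (2 * m * N)) ^ k‖
        ≤ C / (N : ℝ) ^ K := by
  intro K
  have hm0 : m ≠ 0 := by omega
  have hmR : (0 : ℝ) < m := by exact_mod_cast Nat.pos_of_ne_zero hm0
  obtain ⟨C, hC⟩ := exists_norm_integral_mordellFun_sub_le hm0 hE K
  refine ⟨C / (m / (2 * π)) ^ K, fun N hN => ?_⟩
  have hN0 : N ≠ 0 := by omega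
  have hNR : (0 : ℝ) < N := by exact_mod_cast hN
  have hb : (0 : ℝ) < m * N / (2 * π) := by positivity
  have hW : ‖Complex.exp (-(((m : ℂ) - 1) ^ 2) * π * I / (2 * m * N))‖ = 1 := by
    rw [show -(((m : ℂ) - 1) ^ 2) * π * I / (2 * m * N) =
      ((-((m - 1) ^ 2) * π / (2 * m * N) : ℝ) : ℂ) * I by push_cast; ring,
      Complex.norm_exp_ofReal_mul_I]
  have hpi : (π : ℂ) ≠ 0 := by exact_mod_cast Real.pi_ne_zero
  have hpow : ((π : ℂ) * I / (2 * m * N)) = I / (4 * (m * N / (2 * π) : ℝ)) := by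
    push_cast
    field_simp
    norm_num
  have hexp : Complex.exp (3 * (π : ℂ) * I / 4 - ((m : ℂ) - 1) ^ 2 * π * I / (2 * m * N)) =
      Complex.exp (-(((m : ℂ) - 1) ^ 2) * π * I / (2 * m * N)) * -eighthRoot⁻¹ := by
    rw [eighthRoot, ← Complex.exp_neg, ← neg_one_mul (Complex.exp _), ← Complex.exp_pi_mul_I,
      ← Complex.exp_add, ← Complex.exp_add]
    ring_nf
  have hsum : ∑ k ∈ Finset.Icc 1 (m - 1),
      (-1 : ℂ) ^ k * ((k : ℂ) - m) * (Real.sin (k * π / m) : ℂ) *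
        Complex.exp (-((k : ℂ) ^ 2) * (π : ℂ) * I * N / (2 * m)) =
      ∑ k ∈ Finset.Icc 1 (m - 1), (k - m) * poleCoeff m N k := by
    refine Finset.sum_congr rfl fun k _ => ?_
    rw [poleCoeff]
    ring
  have hsqrt : √N * √(2 / m) * √(π / (m * N / (2 * π))) = 2 * π / m := by
    rw [← Real.sqrt_mul hNR.le, ← Real.sqrt_mul (by positivity), Real.sqrt_eq_iff_mul_self_eq
      (by positivity) (by positivity)]
    field_simp
  have hsqrtC : (√N : ℂ) * √(2 / m) * √(π / (m * N / (2 * π))) = 2 * π / m := by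
    exact_mod_cast congrArg (fun x : ℝ => (x : ℂ)) hsqrt
  have hs : (√(π / (m * N / (2 * π))) : ℂ) ≠ 0 := by
    have : 0 < √(π / (m * N / (2 * π))) := by positivity
    exact_mod_cast this.ne'
  have hJ := integral_mordellFun_one hm0 hN0
  have hbd := hC _ hb
  rw [kashaevSum_eq hN0 hm, hexp, hsum, hpow]
  rw [show C / (m / (2 * π)) ^ K / (N : ℝ) ^ K = C / (m * N / (2 * π)) ^ K by
    rw [div_div, ← mul_pow, div_mul_eq_mul_div]]
  refine le_of_eq_of_le ?_ hbd
  generalize (1 / (2 * N) * ∑ r ∈ Finset.range N,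
    ((2 * m * r + m + 1) * quadPhase m N (2 * m * r + m + 1) -
      (2 * m * r + m - 1) * quadPhase m N (2 * m * r + m - 1)) : ℂ) = S at hJ ⊢
  generalize (∑ k ∈ Finset.Icc 1 (m - 1), (k - m) * poleCoeff m N k : ℂ) = P at hJ ⊢
  generalize ∫ x : ℝ, mordellFun m (m * N / (2 * π)) (fun _ => 1) x = J at hJ ⊢
  have hJ' : (√(π / (m * N / (2 * π))) : ℂ)⁻¹ * J =
      S - (√N : ℂ) * -eighthRoot⁻¹ * √(2 / m) * P := by
    rw [inv_mul_eq_iff_eq_mul₀ hs]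
    refine mul_left_cancel₀ (mul_ne_zero (mul_ne_zero two_ne_zero hpi) eighthRoot_ne_zero) ?_
    rw [hJ]
    linear_combination -2 * π * P * hsqrtC * eighthRoot * eighthRoot⁻¹ -
      4 * π ^ 2 / m * P * mul_inv_cancel₀ eighthRoot_ne_zero
  refine Eq.trans ?_ (one_mul _)
  rw [hJ', ← hW, ← norm_mul]
  congr 1
  ring
end
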